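/- Let G be a finite simple graph with maximum degree at most 3, let S be a set of vertices of G admitting a vertically extensible partial drawing, and let C be a chordless cycle of length at least 4 in the subgraph of G induced on the complement of S. Then there exists a vertically extensible partial drawing of S ∪ C. -/

import Mathlib

open InnerProductGeometry

noncomputable section

/-- Points of three-dimensional Euclidean space. -/
abbrev Pt : Type := EuclideanSpace ℝ (Fin 3)

/-- The image of a polyline given by a list of points: the union of the closed
segments between consecutive points. -/
def polyImage (l : List Pt) : Set Pt :=
  ⋃ q ∈ l.zip l.tail, segment ℝ q.1 q.2

/-- A polyline is simple (its image is a simple arc): consecutive points are distinct,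
two consecutive segments meet exactly in their shared endpoint, and two
non-consecutive segments are disjoint. -/
def SimplePolyline (l : List Pt) : Prop :=
  l.Chain' (· ≠ ·) ∧
  ∀ i j : ℕ, ∀ hi : i + 1 < l.length, ∀ hj : j + 1 < l.length, i < j →
    segment ℝ (l.get ⟨i, by omega⟩) (l.get ⟨i + 1, hi⟩) ∩
      segment ℝ (l.get ⟨j, by omega⟩) (l.get ⟨j + 1, hj⟩) =
      if j = i + 1 then {l.get ⟨j, by omega⟩} else ∅

/-- A polyline drawing of a (finite simple) graph `G` in ℝ³: an injective placement
`p` of the vertices, and for each (oriented) edge `uv` a list of points, starting at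
`p u` and ending at `p v`, giving the polygonal path of the edge; the path of `vu`
is the reverse of the path of `uv`.  The interior points of the list are the bends
of the edge. -/
structure PolylineDrawing {V : Type*} (G : SimpleGraph V) where
  p : V → Pt
  p_inj : Function.Injective p
  seq : ∀ u v : V, G.Adj u v → List Pt
  seq_head : ∀ u v h, (seq u v h).head? = some (p u)
  seq_last : ∀ u v h, (seq u v h).getLast? = some (p v)
  seq_symm : ∀ u v h, seq v u h.symm = (seq u v h).reverse

variable {V : Type*} {G : SimpleGraph V}

/-- Every edge is drawn with at most `k` bends, i.e. its point list has at most
`k + 2` points. -/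
def MaxBends (D : PolylineDrawing G) (k : ℕ) : Prop :=
  ∀ u v h, (D.seq u v h).length ≤ k + 2

/-- The image of the whole drawing: all vertex points and all edge paths. -/
def drawingImage (D : PolylineDrawing G) : Set Pt :=
  Set.range D.p ∪ ⋃ (u) (v) (h : G.Adj u v), polyImage (D.seq u v h)

/-- The drawing has angular resolution at least `θ`: the angle at every bend of every
edge, and the angle at a common vertex between the initial segments of any two
distinct edges, is at least `θ`. -/
def AngularResAtLeast (D : PolylineDrawing G) (θ : ℝ) : Prop :=
  (∀ u v h, ∀ a q b : Pt, [a, q, b] <:+: D.seq u v h →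
    θ ≤ angle (a - q) (b - q)) ∧
  (∀ v u w : V, ∀ hu : G.Adj v u, ∀ hw : G.Adj v w, u ≠ w →
    ∀ a b : Pt, (D.seq v u hu)[1]? = some a → (D.seq v w hw)[1]? = some b →
      θ ≤ angle (a - D.p v) (b - D.p v))

/-- The drawing is non-crossing: every edge path is a simple arc meeting the vertex
points only in its endpoints, and the paths of two distinct edges intersect exactly
in the images of their common endpoints. -/
def NonCrossing (D : PolylineDrawing G) : Prop :=
  (∀ u v h, SimplePolyline (D.seq u v h)) ∧
  (∀ u v h, polyImage (D.seq u v h) ∩ Set.range D.p = {D.p u, D.p v}) ∧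
  (∀ u v u' v' : V, ∀ h : G.Adj u v, ∀ h' : G.Adj u' v', s(u, v) ≠ s(u', v') →
    polyImage (D.seq u v h) ∩ polyImage (D.seq u' v' h') =
      D.p '' (({u, v} : Set V) ∩ {u', v'}))

/-- The unit vector in the positive `z`-direction. -/
def zDir : Pt := EuclideanSpace.single 2 1

/-- The open ray from `q` in the positive `z`-direction. -/
def zRay (q : Pt) : Set Pt := {x : Pt | ∃ t : ℝ, 0 < t ∧ x = q + t • zDir}

/-- `D` is a vertically extensible partial drawing of the vertex set `S` of `G`:
a non-crossing drawing of the induced subgraph `G[S]` with angular resolution at least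
`2π/3` and at most two bends per edge, such that every vertex of `S` has at most one
neighbor outside `S`; for every `v ∈ S` with a neighbor outside `S`, placing that
neighbor anywhere on the open ray from `p v` in the positive `z`-direction and joining
it to `p v` by a straight segment stays disjoint from the rest of the drawing
(`ray_clear`) and makes angles at least `2π/3` with the initial segments of the edges
at `v` (`ray_angle`), so that for every choice of the point the extended drawing of
`G[S ∪ {w}]` is non-crossing with angular resolution at least `2π/3` and no bends on
`vw`; and no three extension rays are coplanar. -/
structure IsVertExtensible {V : Type*} (G : SimpleGraph V) (S : Set V)
    (D : PolylineDrawing (G.induce S)) : Prop where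
  noncross : NonCrossing D
  bends : MaxBends D 2
  res : AngularResAtLeast D (2 * Real.pi / 3)
  out_unique : ∀ v : S, ∀ w w' : V, w ∉ S → w' ∉ S →
    G.Adj (v : V) w → G.Adj (v : V) w' → w = w'
  ray_clear : ∀ v : S, (∃ w, w ∉ S ∧ G.Adj (v : V) w) →
    zRay (D.p v) ∩ drawingImage D = ∅
  ray_angle : ∀ v : S, (∃ w, w ∉ S ∧ G.Adj (v : V) w) →
    ∀ u : S, ∀ h : (G.induce S).Adj v u, ∀ a : Pt, (D.seq v u h)[1]? = some a →
      2 * Real.pi / 3 ≤ angle zDir (a - D.p v)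
  rays_noncoplanar : ∀ v₁ v₂ v₃ : S,
    (∃ w, w ∉ S ∧ G.Adj (v₁ : V) w) → (∃ w, w ∉ S ∧ G.Adj (v₂ : V) w) →
    (∃ w, w ∉ S ∧ G.Adj (v₃ : V) w) →
    v₁ ≠ v₂ → v₁ ≠ v₃ → v₂ ≠ v₃ →
    ¬ Coplanar ℝ (zRay (D.p v₁) ∪ zRay (D.p v₂) ∪ zRay (D.p v₃))

/-- The planar cross product of `b - a` and `c - a`: it vanishes exactly when the three
points are collinear. -/
def crossAt (a b c : ℂ) : ℝ :=
  (b - a).re * (c - a).im - (b - a).im * (c - a).re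

theorem crossAt_rotate (a b c : ℂ) : crossAt b c a = crossAt a b c := by
  simp only [crossAt, Complex.sub_re, Complex.sub_im]; ring

theorem crossAt_of_mem_segment {a b x : ℂ} (h : x ∈ segment ℝ a b) : crossAt x a b = 0 := by
  obtain ⟨s, t, -, -, hst, rfl⟩ := h
  obtain rfl : s = 1 - t := by linarith
  simp only [crossAt, Complex.sub_re, Complex.sub_im, Complex.add_re, Complex.add_im,
    Complex.real_smul, Complex.mul_re, Complex.mul_im, Complex.ofReal_re, Complex.ofReal_im]
  ring

theorem crossAt_ne_zero_of_norm_eq {a b c : ℂ} (hab : ‖b‖ = ‖a‖) (hac : ‖c‖ = ‖a‖)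
    (h₁ : a ≠ b) (h₂ : a ≠ c) (h₃ : b ≠ c) : crossAt a b c ≠ 0 := by
  intro h
  have e₁ : b.re * b.re + b.im * b.im = a.re * a.re + a.im * a.im := by
    rw [← Complex.normSq_apply, ← Complex.normSq_apply, Complex.normSq_eq_norm_sq,
      Complex.normSq_eq_norm_sq, hab]
  have e₂ : c.re * c.re + c.im * c.im = a.re * a.re + a.im * a.im := by
    rw [← Complex.normSq_apply, ← Complex.normSq_apply, Complex.normSq_eq_norm_sq,
      Complex.normSq_eq_norm_sq, hac]
  simp only [crossAt, Complex.sub_re, Complex.sub_im] at h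
  obtain ⟨a₁, a₂⟩ := a
  obtain ⟨b₁, b₂⟩ := b
  obtain ⟨c₁, c₂⟩ := c
  simp only [ne_eq, Complex.mk.injEq] at *
  obtain ⟨u₁, rfl⟩ : ∃ u, b₁ = a₁ + u := ⟨b₁ - a₁, by ring⟩
  obtain ⟨u₂, rfl⟩ : ∃ u, b₂ = a₂ + u := ⟨b₂ - a₂, by ring⟩
  have hu : 0 < u₁ * u₁ + u₂ * u₂ := by
    rcases eq_or_ne u₁ 0 with rfl | h0
    · rcases eq_or_ne u₂ 0 with rfl | h0
      · simp at h₁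
      · linarith [mul_self_pos.2 h0]
    · linarith [mul_self_pos.2 h0, mul_self_nonneg u₂]
  obtain ⟨t, ht⟩ : ∃ t, t * (u₁ * u₁ + u₂ * u₂) = u₁ * (c₁ - a₁) + u₂ * (c₂ - a₂) :=
    ⟨_, div_mul_cancel₀ _ hu.ne'⟩
  obtain rfl : c₁ = a₁ + t * u₁ := by
    apply mul_right_cancel₀ hu.ne'
    linear_combination -u₁ * ht - u₂ * h
  obtain rfl : c₂ = a₂ + t * u₂ := by
    apply mul_right_cancel₀ hu.ne'
    linear_combination -u₂ * ht + u₁ * h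
  have : t * (t - 1) * (u₁ * u₁ + u₂ * u₂) = 0 := by
    linear_combination e₂ - t * e₁
  rcases mul_eq_zero.1 this with h | h
  · rcases mul_eq_zero.1 h with h | h
    · subst h; simp at h₂
    · obtain rfl : t = 1 := by linarith
      simp at h₃
  · exact hu.ne' h

/-- A finite family of affine lines does not cover the plane. -/
theorem exists_avoiding_lines {ι : Type*} [Finite ι] (d : ι → ℂ) (v : ι → ℝ)
    (hd : ∀ i, d i ≠ 0) : ∃ w : ℂ, ∀ i, w.re * (d i).im - w.im * (d i).re ≠ v i := by
  have hfin : (⋃ i, {s : ℝ | s * (d i).im - s ^ 2 * (d i).re = v i}).Finite := by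
    refine Set.finite_iUnion fun i => ?_
    let q : Polynomial ℝ := Polynomial.C (d i).im * Polynomial.X
      - Polynomial.C (d i).re * Polynomial.X ^ 2 - Polynomial.C (v i)
    have hq : q ≠ 0 := by
      intro h
      apply hd i
      have h1 := congrArg (Polynomial.coeff · 1) h
      have h2 := congrArg (Polynomial.coeff · 2) h
      simp [q, Polynomial.coeff_C] at h1 h2
      exact Complex.ext h2 h1
    refine (q.roots.toFinset.finite_toSet).subset fun s hs => ?_
    simp only [Set.mem_ofPred_eq] at hs
    simp only [Finset.mem_coe, Multiset.mem_toFinset, Polynomial.mem_roots hq,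
      Polynomial.IsRoot.def]
    simp only [q, Polynomial.eval_sub, Polynomial.eval_mul, Polynomial.eval_C,
      Polynomial.eval_X, Polynomial.eval_pow]
    linarith
  obtain ⟨s, hs⟩ := hfin.infinite_compl.nonempty
  refine ⟨⟨s, s ^ 2⟩, fun i hi => hs ?_⟩
  exact Set.mem_iUnion.2 ⟨i, hi⟩

/-- A translation bringing a finite set `Q` into general position with respect to a finite
set `X`. -/
theorem exists_generic_translation {X Q : Set ℂ} (hX : X.Finite) (hQ : Q.Finite) :
    ∃ w : ℂ, (∀ x ∈ X, ∀ a ∈ Q, ∀ b ∈ Q, a ≠ b → crossAt x (a + w) (b + w) ≠ 0) ∧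
      (∀ x ∈ X, ∀ y ∈ X, x ≠ y → ∀ a ∈ Q, crossAt x y (a + w) ≠ 0) := by
  have := hX.to_subtype
  have := hQ.to_subtype
  let ι₁ := {t : X × Q × Q // t.2.1 ≠ t.2.2}
  let ι₂ := {t : Q × X × X // t.2.1 ≠ t.2.2}
  obtain ⟨w, hw⟩ := exists_avoiding_lines (ι := ι₁ ⊕ ι₂)
    (Sum.elim (fun t => (t.1.2.2 : ℂ) - t.1.2.1) (fun t => (t.1.2.2 : ℂ) - t.1.2.1))
    (Sum.elim
      (fun t => ((t.1.1 : ℂ) - t.1.2.1).re * ((t.1.2.2 : ℂ) - t.1.2.1).im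
        - ((t.1.1 : ℂ) - t.1.2.1).im * ((t.1.2.2 : ℂ) - t.1.2.1).re)
      (fun t => ((t.1.2.1 : ℂ) - t.1.1).re * ((t.1.2.2 : ℂ) - t.1.2.1).im
        - ((t.1.2.1 : ℂ) - t.1.1).im * ((t.1.2.2 : ℂ) - t.1.2.1).re))
    (by
      rintro (⟨⟨x, a, b⟩, h⟩ | ⟨⟨a, x, y⟩, h⟩) <;>
      · simp only [Sum.elim_inl, Sum.elim_inr, ne_eq, sub_eq_zero]
        exact fun h' => h (Subtype.ext h'.symm))
  refine ⟨w, fun x hx a ha b hb hab h => ?_, fun x hx y hy hxy a ha h => ?_⟩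
  · refine hw (Sum.inl ⟨⟨⟨x, hx⟩, ⟨a, ha⟩, ⟨b, hb⟩⟩, fun h' => hab (congrArg Subtype.val h')⟩) ?_
    simp only [crossAt, Sum.elim_inl, Complex.sub_re, Complex.sub_im, Complex.add_re,
      Complex.add_im] at h ⊢
    linarith
  · refine hw (Sum.inr ⟨⟨⟨a, ha⟩, ⟨x, hx⟩, ⟨y, hy⟩⟩, fun h' => hxy (congrArg Subtype.val h')⟩) ?_
    simp only [crossAt, Sum.elim_inr, Complex.sub_re, Complex.sub_im, Complex.add_re,
      Complex.add_im] at h ⊢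
    linarith

/-- A strictly convex closed polygon in the plane, in general position with respect to `X`.
Its vertices are, in cyclic order, `P i - d i` and `P i + d i`; the functional `m i`
separates the part of the polygon between `P i` and `P (i + 1)` from the rest. -/
structure CyclePolygon (n : ℕ) (X : Set ℂ) where
  P : ZMod n → ℂ
  d : ZMod n → ℂ
  m : ZMod n → ℂ →ₗ[ℝ] ℝ
  K : ZMod n → ℝ
  norm_d : ∀ i, ‖d i‖ = √3
  chord_ne : ∀ i, P (i + 1) - d (i + 1) - (P i + d i) ≠ 0
  turn_left : ∀ i, ‖P (i + 1) - d (i + 1) - (P i + d i)‖ ≤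
    inner ℝ (d i) (P (i + 1) - d (i + 1) - (P i + d i))
  turn_right : ∀ i, ‖P (i + 1) - d (i + 1) - (P i + d i)‖ ≤
    inner ℝ (d (i + 1)) (P (i + 1) - d (i + 1) - (P i + d i))
  m_self : ∀ i, m i (P i) = K i
  m_succ : ∀ i, m i (P (i + 1)) = K i
  m_left : ∀ i, K i < m i (P i + d i)
  m_right : ∀ i, K i < m i (P (i + 1) - d (i + 1))
  m_other : ∀ i j, j ≠ i → j ≠ i + 1 → m i (P j) < K i
  m_other_left : ∀ i j, j ≠ i → m i (P j + d j) < K i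
  m_other_right : ∀ i j, j ≠ i + 1 → m i (P j - d j) < K i
  P_inj : Function.Injective P
  P_cross : ∀ i j k, i ≠ j → i ≠ k → j ≠ k → crossAt (P i) (P j) (P k) ≠ 0
  X_P_P : ∀ x ∈ X, ∀ i j, i ≠ j → crossAt x (P i) (P j) ≠ 0
  X_X_P : ∀ x ∈ X, ∀ y ∈ X, x ≠ y → ∀ i, crossAt x y (P i) ≠ 0
  X_left : ∀ x ∈ X, ∀ i, crossAt x (P i) (P i + d i) ≠ 0
  X_mid : ∀ x ∈ X, ∀ i, crossAt x (P i + d i) (P (i + 1) - d (i + 1)) ≠ 0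
  X_right : ∀ x ∈ X, ∀ i, crossAt x (P i - d i) (P i) ≠ 0

theorem toCircle_re_lt {n : ℕ} [NeZero n] (hn : 4 ≤ n) (k : ZMod n) (h0 : k ≠ 0)
    (h1 : k ≠ 1) :
    ((ZMod.toCircle k : ℂ) * Complex.exp (-((Real.pi / n : ℝ) : ℂ) * Complex.I)).re
      < Real.cos (Real.pi / n) := by
  have hn0 : (0 : ℝ) < n := by exact_mod_cast (by omega : 0 < n)
  have : Fact (1 < n) := ⟨by omega⟩
  have hk : 2 ≤ k.val := by
    by_contra h
    have : k.val = 0 ∨ k.val = 1 := by omega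
    rcases this with h | h
    · exact h0 ((ZMod.val_eq_zero k).1 h)
    · exact h1 (ZMod.val_injective n (by rw [h, ZMod.val_one]))
  have hk' : k.val + 1 ≤ n := ZMod.val_lt k
  rw [ZMod.toCircle_apply, ← Complex.exp_add]
  have : (2 * (Real.pi : ℂ) * Complex.I * k.val / n
      + -((Real.pi / n : ℝ) : ℂ) * Complex.I) =
      (((2 * k.val - 1) * (Real.pi / n) : ℝ) : ℂ) * Complex.I := by
    push_cast; ring
  rw [this, Complex.exp_ofReal_mul_I_re]
  have hα : 0 < Real.pi / n := div_pos Real.pi_pos hn0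
  have hαn : n * (Real.pi / n) = Real.pi := by field_simp
  set α := Real.pi / n
  have a1 : (2 : ℝ) ≤ k.val := by exact_mod_cast hk
  have a2 : (k.val : ℝ) + 1 ≤ n := by exact_mod_cast hk'
  rcases le_total ((2 * k.val - 1) * α) Real.pi with h | h
  · exact Real.cos_lt_cos_of_nonneg_of_le_pi hα.le h (by nlinarith)
  · rw [← Real.cos_two_pi_sub ((2 * k.val - 1) * α)]
    exact Real.cos_lt_cos_of_nonneg_of_le_pi hα.le (by linarith) (by nlinarith)

theorem exists_cyclePolygon {n : ℕ} (hn : 4 ≤ n) {X : Set ℂ} (hX : X.Finite) :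
    Nonempty (CyclePolygon n X) := by
  have : NeZero n := ⟨by omega⟩
  have : Fact (1 < n) := ⟨by omega⟩
  have hn4 : (4 : ℝ) ≤ n := by exact_mod_cast hn
  have hn0 : (0 : ℝ) < n := by linarith
  have hpi := Real.pi_pos
  set α : ℝ := Real.pi / n with hα
  have hα0 : 0 < α := div_pos hpi hn0
  have hα4 : α ≤ Real.pi / 4 := by rw [hα]; gcongr
  set c := Real.cos α with hc
  set s := Real.sin α with hs
  have hs0 : 0 < s := Real.sin_pos_of_pos_of_lt_pi hα0 (by linarith)
  have hcl : √2 / 2 ≤ c := by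
    rw [← Real.cos_pi_div_four]
    exact Real.cos_le_cos_of_nonneg_of_le_pi hα0.le (by linarith) hα4
  have hcs : s ^ 2 + c ^ 2 = 1 := Real.sin_sq_add_cos_sq α
  have h3c : 1 ≤ √3 * c := by
    have h6 : √3 * √2 = √6 := by
      rw [← Real.sqrt_mul (by norm_num)]; norm_num
    have : (2 : ℝ) ≤ √6 := by rw [Real.le_sqrt] <;> norm_num
    have := mul_le_mul_of_nonneg_left hcl (Real.sqrt_nonneg 3)
    linarith
  have h30 : 0 < √3 := by positivity
  have hc0 : 0 < c := by
    by_contra h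
    nlinarith
  let χ : ZMod n → ℂ := fun i => (ZMod.toCircle i : ℂ)
  have χ_ne : ∀ i, χ i ≠ 0 := fun i => Circle.coe_ne_zero _
  have χ_norm : ∀ i, ‖χ i‖ = 1 := fun i => Circle.norm_coe _
  have χ_inj : Function.Injective χ := fun i j h =>
    ZMod.injective_toCircle (Subtype.ext h)
  have χ_add : ∀ i j, χ (i + j) = χ i * χ j := fun i j => by
    simp only [χ, AddChar.map_add_eq_mul, Circle.coe_mul]
  have χ_conj : ∀ i, (starRingEnd ℂ) (χ i) * χ i = 1 := fun i => by
    rw [mul_comm, Complex.mul_conj, Complex.normSq_eq_norm_sq, χ_norm]; simp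
  let η : ℂ := ⟨c, s⟩
  have χ_one : χ 1 = η * η := by
    have h1 : η = Complex.exp ((α : ℂ) * Complex.I) := by
      apply Complex.ext
      · rw [Complex.exp_ofReal_mul_I_re]
      · rw [Complex.exp_ofReal_mul_I_im]
    have h2 := ZMod.toCircle_intCast (N := n) 1
    simp only [Int.cast_one] at h2
    simp only [χ]
    rw [h2, h1, ← Complex.exp_add]
    congr 1
    rw [hα]
    push_cast
    ring
  let η' : ℂ := ⟨c, -s⟩
  have η'_conj : (starRingEnd ℂ) η = η' := rfl
  have ηη' : η * η' = 1 := by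
    apply Complex.ext <;> simp [η, η'] <;> nlinarith
  have η'_norm : ‖η'‖ = 1 := by
    have := congrArg norm ηη'
    rw [← η'_conj, norm_mul, RCLike.norm_conj, norm_one] at this
    rw [← η'_conj, RCLike.norm_conj]
    nlinarith [norm_nonneg η]
  have κ_lt : ∀ k : ZMod n, k ≠ 0 → k ≠ 1 → (χ k * η').re < c := by
    intro k h0 h1
    have := toCircle_re_lt hn k h0 h1
    have e : Complex.exp (-((Real.pi / n : ℝ) : ℂ) * Complex.I) = η' := by
      rw [← Complex.ofReal_neg]
      apply Complex.ext
      · rw [Complex.exp_ofReal_mul_I_re, Real.cos_neg]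
      · rw [Complex.exp_ofReal_mul_I_im, Real.sin_neg]
    rwa [e] at this
  have σ_le : ∀ k : ZMod n, |(χ k * η').im| ≤ 1 := fun k => by
    refine (Complex.abs_im_le_norm _).trans ?_
    rw [norm_mul, χ_norm, η'_norm, one_mul]
  obtain ⟨R, hR0, hRs, hRκ⟩ : ∃ R : ℝ, 0 < R ∧ √3 * c < R * s ∧
      ∀ k : ZMod n, k ≠ 0 → k ≠ 1 → √3 < R * (c - (χ k * η').re) := by
    have : ∀ᶠ R : ℝ in Filter.atTop, 0 < R ∧ √3 * c < R * s ∧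
        ∀ k : ZMod n, k ≠ 0 → k ≠ 1 → √3 < R * (c - (χ k * η').re) := by
      refine (Filter.eventually_gt_atTop 0).and (.and ?_ ?_)
      · exact (Filter.tendsto_id.atTop_mul_const hs0).eventually_gt_atTop _
      · refine Filter.eventually_all.2 fun k => ?_
        by_cases h : k ≠ 0 ∧ k ≠ 1
        · filter_upwards [(Filter.tendsto_id.atTop_mul_const
            (sub_pos.2 (κ_lt k h.1 h.2))).eventually_gt_atTop (√3)] with R hR _ _ using hR
        · exact Filter.Eventually.of_forall fun R h0 h1 => absurd ⟨h0, h1⟩ h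
    exact this.exists
  let P : ZMod n → ℂ := fun i => χ i * R
  let d : ZMod n → ℂ := fun i => χ i * ⟨0, √3⟩
  have hQ : (Set.range P ∪ Set.range (fun i => P i + d i) ∪
      Set.range (fun i => P i - d i)).Finite :=
    ((Set.finite_range _).union (Set.finite_range _)).union (Set.finite_range _)
  obtain ⟨w, hw₁, hw₂⟩ := exists_generic_translation hX hQ
  have memP : ∀ i, P i ∈ Set.range P ∪ Set.range (fun i => P i + d i) ∪
      Set.range (fun i => P i - d i) := fun i => Or.inl (Or.inl ⟨i, rfl⟩)
  have memB : ∀ i, P i + d i ∈ Set.range P ∪ Set.range (fun i => P i + d i) ∪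
      Set.range (fun i => P i - d i) := fun i => Or.inl (Or.inr ⟨i, rfl⟩)
  have memA : ∀ i, P i - d i ∈ Set.range P ∪ Set.range (fun i => P i + d i) ∪
      Set.range (fun i => P i - d i) := fun i => Or.inr ⟨i, rfl⟩
  have d_norm : ∀ i, ‖d i‖ = √3 := fun i => by
    have : (⟨0, √3⟩ : ℂ) = (√3 : ℝ) * Complex.I := by
      apply Complex.ext <;> simp
    simp only [d]
    rw [norm_mul, χ_norm, this, norm_mul, Complex.norm_I, Complex.norm_real]
    simp
  have d_ne : ∀ i, d i ≠ 0 := fun i h => by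
    have := d_norm i
    rw [h, norm_zero] at this
    linarith
  have P_inj : Function.Injective P := fun i j h =>
    χ_inj (mul_right_cancel₀ (by exact_mod_cast hR0.ne') h)
  have chord : ∀ i, P (i + 1) - d (i + 1) - (P i + d i) =
      χ i * (η * ⟨0, 2 * (R * s - √3 * c)⟩) := fun i => by
    have : η * η * (R - ⟨0, √3⟩) - (R + ⟨0, √3⟩) =
        η * ⟨0, 2 * (R * s - √3 * c)⟩ := by
      have hc2 : c ^ 2 = 1 - s ^ 2 := by linarith
      apply Complex.ext <;> simp [η] <;> ring_nf <;> rw [hc2] <;> ring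
    rw [← this]
    simp only [P, d, χ_add, χ_one]
    ring
  have η_norm : ‖η‖ = 1 := by
    rw [← η'_norm, ← η'_conj, RCLike.norm_conj]
  have chord_norm : ∀ i, ‖P (i + 1) - d (i + 1) - (P i + d i)‖ = 2 * (R * s - √3 * c) :=
    fun i => by
    have : (⟨0, 2 * (R * s - √3 * c)⟩ : ℂ) = (2 * (R * s - √3 * c) : ℝ) * Complex.I := by
      apply Complex.ext <;> simp
    rw [chord, norm_mul, norm_mul, χ_norm, η_norm, this, norm_mul, Complex.norm_I,
      Complex.norm_real, Real.norm_of_nonneg (by linarith)]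
    ring
  have inner_rot : ∀ (i : ZMod n) (z z' : ℂ), inner ℝ (χ i * z) (χ i * z') =
      (z' * (starRingEnd ℂ) z).re := fun i z z' => by
    rw [Complex.inner, map_mul]
    congr 1
    linear_combination (z' * (starRingEnd ℂ) z) * χ_conj i
  let m : ZMod n → ℂ →ₗ[ℝ] ℝ := fun i =>
    Complex.reLm ∘ₗ LinearMap.mul ℝ ℂ ((starRingEnd ℂ) (χ i) * η')
  have m_apply : ∀ (i k : ZMod n) (z : ℂ), m i (χ (i + k) * z) =
      (χ k * η').re * z.re - (χ k * η').im * z.im := fun i k z => by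
    have : (starRingEnd ℂ) (χ i) * η' * (χ (i + k) * z) = χ k * η' * z := by
      rw [χ_add]
      linear_combination (χ k * η' * z) * χ_conj i
    change ((starRingEnd ℂ) (χ i) * η' * (χ (i + k) * z)).re = _
    rw [this, Complex.mul_re]
  have χ0 : χ 0 * η' = η' := by simp [χ]
  have χ1 : χ 1 * η' = η := by rw [χ_one, mul_assoc, ηη', mul_one]
  have mP : ∀ i k, m i (P (i + k)) = R * (χ k * η').re := fun i k => by
    simp only [P, m_apply]; simp; ring
  have mB : ∀ i k, m i (P (i + k) + d (i + k)) =
      R * (χ k * η').re - √3 * (χ k * η').im := fun i k => by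
    simp only [P, d, map_add, m_apply]; simp; ring
  have mA : ∀ i k, m i (P (i + k) - d (i + k)) =
      R * (χ k * η').re + √3 * (χ k * η').im := fun i k => by
    simp only [P, d, map_sub, m_apply]; simp; ring
  have m0 : ∀ i, m i (P i) = R * c := fun i => by
    have := mP i 0; rwa [add_zero, χ0] at this
  have m0B : ∀ i, m i (P i + d i) = R * c + √3 * s := fun i => by
    have := mB i 0; rw [add_zero, χ0] at this; simpa [η'] using this
  have m0A : ∀ i, m i (P i - d i) = R * c - √3 * s := fun i => by
    have := mA i 0; rw [add_zero, χ0] at this; rw [this]; simp only [η']; ring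
  have m1 : ∀ i, m i (P (i + 1)) = R * c := fun i => by
    have := mP i 1; rwa [χ1] at this
  have m1B : ∀ i, m i (P (i + 1) + d (i + 1)) = R * c - √3 * s := fun i => by
    have := mB i 1; rwa [χ1] at this
  have m1A : ∀ i, m i (P (i + 1) - d (i + 1)) = R * c + √3 * s := fun i => by
    have := mA i 1; rwa [χ1] at this
  have h3s : 0 < √3 * s := by positivity
  have σ_bound : ∀ k, |√3 * (χ k * η').im| ≤ √3 := fun k => by
    rw [abs_mul, abs_of_pos h30]
    nlinarith [σ_le k]
  refine ⟨{
    P := fun i => P i + w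
    d := d
    m := m
    K := fun i => R * c + m i w
    norm_d := d_norm
    chord_ne := fun i h => ?_
    turn_left := fun i => ?_
    turn_right := fun i => ?_
    m_self := fun i => by rw [map_add, m0]
    m_succ := fun i => by rw [map_add, m1]
    m_left := fun i => by rw [add_right_comm, map_add, m0B]; linarith
    m_right := fun i => by rw [add_sub_right_comm, map_add, m1A]; linarith
    m_other := fun i j h0 h1 => ?_
    m_other_left := fun i j h0 => ?_
    m_other_right := fun i j h1 => ?_
    P_inj := fun i j h => P_inj (add_right_cancel h)
    P_cross := fun i j k hij hik hjk => ?_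
    X_P_P := fun x hx i j hij => hw₁ x hx _ (memP i) _ (memP j) (P_inj.ne hij)
    X_X_P := fun x hx y hy hxy i => hw₂ x hx y hy hxy _ (memP i)
    X_left := fun x hx i => ?_
    X_mid := fun x hx i => ?_
    X_right := fun x hx i => ?_ }⟩
  · have e : P (i + 1) + w - d (i + 1) - (P i + w + d i) =
      P (i + 1) - d (i + 1) - (P i + d i) := by ring
    rw [e] at h
    have := chord_norm i
    rw [h, norm_zero] at this
    linarith
  · have e : P (i + 1) + w - d (i + 1) - (P i + w + d i) =
      P (i + 1) - d (i + 1) - (P i + d i) := by ring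
    rw [e, chord_norm, chord]
    simp only [d]
    rw [inner_rot]
    simp [η]
    nlinarith
  · have e : P (i + 1) + w - d (i + 1) - (P i + w + d i) =
      P (i + 1) - d (i + 1) - (P i + d i) := by ring
    rw [e, chord_norm, chord]
    simp only [d]
    rw [χ_add, χ_one, mul_assoc, inner_rot]
    have e' : (η * ⟨0, 2 * (R * s - √3 * c)⟩ * (starRingEnd ℂ) (η * η * ⟨0, √3⟩)).re =
        2 * (√3 * c) * (R * s - √3 * c) * (s ^ 2 + c ^ 2) := by
      simp [η]; ring
    rw [e', hcs]
    nlinarith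
  · obtain ⟨k, rfl⟩ : ∃ k, j = i + k := ⟨j - i, by ring⟩
    rw [map_add, mP]
    have := hRκ k (by rintro rfl; simp at h0) (by rintro rfl; simp at h1)
    linarith
  · obtain ⟨k, rfl⟩ : ∃ k, j = i + k := ⟨j - i, by ring⟩
    rw [add_right_comm, map_add]
    by_cases hk : k = 1
    · subst hk; rw [m1B]; linarith
    · rw [mB]
      have := hRκ k (by rintro rfl; simp at h0) hk
      linarith [abs_le.1 (σ_bound k)]
  · obtain ⟨k, rfl⟩ : ∃ k, j = i + k := ⟨j - i, by ring⟩
    rw [add_sub_right_comm, map_add]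
    by_cases hk : k = 0
    · subst hk; rw [add_zero, m0A]; linarith
    · rw [mA]
      have := hRκ k hk (by rintro rfl; simp at h1)
      linarith [abs_le.1 (σ_bound k)]
  · have : crossAt (P i + w) (P j + w) (P k + w) = crossAt (P i) (P j) (P k) := by
      simp [crossAt]
    rw [this]
    have hP : ∀ i, ‖P i‖ = R := fun i => by
      simp only [P]
      rw [norm_mul, χ_norm, Complex.norm_real, Real.norm_of_nonneg hR0.le, one_mul]
    exact crossAt_ne_zero_of_norm_eq (by rw [hP, hP]) (by rw [hP, hP]) (P_inj.ne hij)
      (P_inj.ne hik) (P_inj.ne hjk)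
  · rw [add_right_comm]
    refine hw₁ x hx _ (memP i) _ (memB i) fun h => d_ne i ?_
    simpa using h
  · rw [add_right_comm, add_sub_right_comm]
    refine hw₁ x hx _ (memB i) _ (memA (i + 1)) fun h => ?_
    have := chord_norm i
    rw [← h, sub_self, norm_zero] at this
    linarith
  · rw [add_sub_right_comm]
    refine hw₁ x hx _ (memA i) _ (memP i) fun h => d_ne i ?_
    simpa using h

/-- The point of space above a point `w` of the plane at height `z`. -/
def liftPt (w : ℂ) (z : ℝ) : Pt := !₂[w.re, w.im, z]

/-- The vertical projection to the plane. -/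
def projPlane : Pt →ₗ[ℝ] ℂ where
  toFun x := ⟨x 0, x 1⟩
  map_add' x y := by apply Complex.ext <;> simp
  map_smul' t x := by apply Complex.ext <;> simp

/-- The height function. -/
def height : Pt →ₗ[ℝ] ℝ where
  toFun x := x 2
  map_add' x y := by simp
  map_smul' t x := by simp

theorem height_apply (x : Pt) : height x = x 2 := rfl

@[simp] theorem projPlane_liftPt (w : ℂ) (z : ℝ) : projPlane (liftPt w z) = w := by
  apply Complex.ext <;> simp [projPlane, liftPt]

@[simp] theorem height_liftPt (w : ℂ) (z : ℝ) : height (liftPt w z) = z := by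
  simp [height_apply, liftPt]

@[simp] theorem projPlane_zDir : projPlane zDir = 0 := by
  apply Complex.ext <;> simp [projPlane, zDir]

@[simp] theorem height_zDir : height zDir = 1 := by
  simp [height_apply, zDir]

theorem pt_ext {x y : Pt} (h : projPlane x = projPlane y) (h' : height x = height y) :
    x = y := by
  ext i
  fin_cases i
  · exact congrArg Complex.re h
  · exact congrArg Complex.im h
  · exact h'

theorem inner_eq_proj_add_height (x y : Pt) :
    inner ℝ x y = inner ℝ (projPlane x) (projPlane y) + height x * height y := by
  simp [PiLp.inner_apply, Fin.sum_univ_three, Complex.inner, projPlane, height_apply]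
  ring

theorem norm_eq_of_proj_height {x : Pt} {r : ℝ} (hr : 0 ≤ r)
    (h : ‖projPlane x‖ ^ 2 + height x ^ 2 = r ^ 2) : ‖x‖ = r := by
  rw [← sq_eq_sq₀ (norm_nonneg _) hr, ← real_inner_self_eq_norm_sq,
    inner_eq_proj_add_height, real_inner_self_eq_norm_sq, ← h]
  ring

theorem mem_zRay_iff {q x : Pt} :
    x ∈ zRay q ↔ projPlane x = projPlane q ∧ height q < height x := by
  constructor
  · rintro ⟨t, ht, rfl⟩
    simp [ht]
  · rintro ⟨h₁, h₂⟩
    refine ⟨height x - height q, sub_pos.2 h₂, pt_ext ?_ ?_⟩ <;> simp [h₁]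

theorem liftPt_sub (w w' : ℂ) (z z' : ℝ) :
    liftPt w z - liftPt w' z' = liftPt (w - w') (z - z') :=
  pt_ext (by simp) (by simp)

theorem two_pi_div_three_le_angle {x y : Pt} (hx : x ≠ 0) (hy : y ≠ 0)
    (h : 2 * inner ℝ x y ≤ -(‖x‖ * ‖y‖)) : 2 * Real.pi / 3 ≤ angle x y := by
  have hpi := Real.pi_pos
  have hcos : Real.cos (2 * Real.pi / 3) = -(1 / 2) := by
    rw [← Real.cos_pi_div_three, ← Real.cos_pi_sub]
    congr 1
    ring
  rw [angle, ← Real.arccos_cos (x := 2 * Real.pi / 3) (by positivity) (by linarith), hcos]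
  apply Real.arccos_le_arccos
  have : 0 < ‖x‖ * ‖y‖ := mul_pos (norm_pos_iff.2 hx) (norm_pos_iff.2 hy)
  rw [div_le_iff₀ this]
  linarith

theorem angle_eq_of_smul_zDir {t : ℝ} (ht : 0 < t) (x : Pt) :
    angle (t • zDir) x = angle zDir x :=
  angle_smul_left_of_pos _ _ ht

theorem liftPt_sub_eq_smul_zDir {q : Pt} {h : ℝ} :
    liftPt (projPlane q) h - q = (h - height q) • zDir :=
  pt_ext (by simp) (by simp)

theorem eq_of_mem_segment_of_le {φ : Pt →ₗ[ℝ] ℝ} {a b x : Pt} {k : ℝ} (ha : φ a ≤ k)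
    (hb : φ b < k) (hx : x ∈ segment ℝ a b) (hk : k ≤ φ x) : x = a := by
  obtain ⟨s, t, hs, ht, hst, rfl⟩ := hx
  simp only [map_add, map_smul, smul_eq_mul] at hk
  obtain rfl : t = 0 := by
    by_contra h
    have : 0 < t := lt_of_le_of_ne ht (Ne.symm h)
    obtain rfl : s = 1 - t := by linarith
    nlinarith
  obtain rfl : s = 1 := by linarith
  simp

theorem le_of_mem_segment {φ : Pt →ₗ[ℝ] ℝ} {a b x : Pt} {k : ℝ} (ha : φ a ≤ k)
    (hb : φ b ≤ k) (hx : x ∈ segment ℝ a b) : φ x ≤ k := by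
  obtain ⟨s, t, hs, ht, hst, rfl⟩ := hx
  simp only [map_add, map_smul, smul_eq_mul]
  obtain rfl : s = 1 - t := by linarith
  nlinarith

theorem ge_of_mem_segment {φ : Pt →ₗ[ℝ] ℝ} {a b x : Pt} {k : ℝ} (ha : k ≤ φ a)
    (hb : k ≤ φ b) (hx : x ∈ segment ℝ a b) : k ≤ φ x := by
  have := le_of_mem_segment (φ := -φ) (k := -k) (by simpa using ha) (by simpa using hb) hx
  simpa using this

theorem map_mem_segment {E F : Type*} [AddCommGroup E] [Module ℝ E] [AddCommGroup F]
    [Module ℝ F] (φ : E →ₗ[ℝ] F) {a b x : E} (hx : x ∈ segment ℝ a b) :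
    φ x ∈ segment ℝ (φ a) (φ b) := by
  obtain ⟨s, t, hs, ht, hst, rfl⟩ := hx
  exact ⟨s, t, hs, ht, hst, by simp⟩

theorem mem_zip_tail_iff {α : Type*} {l : List α} {a b : α} :
    (a, b) ∈ l.zip l.tail ↔ [a, b] <:+: l := by
  induction l with
  | nil => simp
  | cons c l ih =>
    rw [List.infix_cons_iff, ← ih]
    cases l with
    | nil => simp
    | cons e l => simp [List.prefix_cons_iff]

theorem polyImage_reverse (l : List Pt) : polyImage l.reverse = polyImage l := by
  have key : ∀ l : List Pt, polyImage l.reverse ⊆ polyImage l := by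
    intro l x hx
    simp only [polyImage, Set.mem_iUnion, Prod.exists, mem_zip_tail_iff, exists_prop] at hx ⊢
    obtain ⟨a, b, h, hx⟩ := hx
    refine ⟨b, a, ?_, by rwa [segment_symm]⟩
    simpa using h.reverse
  refine (key l).antisymm ?_
  conv_lhs => rw [← List.reverse_reverse l]
  exact key _

theorem mem_polyImage_four {a b c d x : Pt} :
    x ∈ polyImage [a, b, c, d] ↔
      x ∈ segment ℝ a b ∨ x ∈ segment ℝ b c ∨ x ∈ segment ℝ c d := by
  simp [polyImage]

theorem eq_of_three_consecutive_of_four {α : Type*} {a b c d x y z : α}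
    (h : [x, y, z] <:+: [a, b, c, d]) :
    (x = a ∧ y = b ∧ z = c) ∨ (x = b ∧ y = c ∧ z = d) := by
  simpa [List.infix_cons_iff, List.prefix_cons_iff] using h

theorem eq_endpoint_of_le {φ : Pt →ₗ[ℝ] ℝ} {a b c d x : Pt} {k : ℝ} (ha : φ a ≤ k)
    (hb : φ b < k) (hc : φ c < k) (hd : φ d ≤ k) (hx : x ∈ polyImage [a, b, c, d])
    (hk : k ≤ φ x) : x = a ∨ x = d := by
  rcases mem_polyImage_four.1 hx with h | h | h
  · exact Or.inl (eq_of_mem_segment_of_le ha hb h hk)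
  · obtain rfl := eq_of_mem_segment_of_le hb.le hc h hk
    exact absurd hk (not_le.2 hb)
  · rw [segment_symm] at h
    exact Or.inr (eq_of_mem_segment_of_le hd hc h hk)

theorem eq_endpoint_of_ge {φ : Pt →ₗ[ℝ] ℝ} {a b c d x : Pt} {k : ℝ} (ha : k ≤ φ a)
    (hb : k < φ b) (hc : k < φ c) (hd : k ≤ φ d) (hx : x ∈ polyImage [a, b, c, d])
    (hk : φ x ≤ k) : x = a ∨ x = d :=
  eq_endpoint_of_le (φ := -φ) (k := -k) (by simpa using ha) (by simpa using hb)
    (by simpa using hc) (by simpa using hd) hx (by simpa using hk)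

theorem le_of_mem_polyImage {φ : Pt →ₗ[ℝ] ℝ} {a b c d x : Pt} {k : ℝ} (ha : φ a ≤ k)
    (hb : φ b ≤ k) (hc : φ c ≤ k) (hd : φ d ≤ k) (hx : x ∈ polyImage [a, b, c, d]) :
    φ x ≤ k := by
  rcases mem_polyImage_four.1 hx with h | h | h
  · exact le_of_mem_segment ha hb h
  · exact le_of_mem_segment hb hc h
  · exact le_of_mem_segment hc hd h

theorem ge_of_mem_polyImage {φ : Pt →ₗ[ℝ] ℝ} {a b c d x : Pt} {k : ℝ} (ha : k ≤ φ a)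
    (hb : k ≤ φ b) (hc : k ≤ φ c) (hd : k ≤ φ d) (hx : x ∈ polyImage [a, b, c, d]) :
    k ≤ φ x := by
  have := le_of_mem_polyImage (φ := -φ) (k := -k) (by simpa using ha) (by simpa using hb)
    (by simpa using hc) (by simpa using hd) hx
  simpa using this

theorem segment_inter_of_lt {φ : Pt →ₗ[ℝ] ℝ} {a b c : Pt} (h₁ : φ a < φ b)
    (h₂ : φ b < φ c) : segment ℝ a b ∩ segment ℝ b c = {b} := by
  ext x
  constructor
  · rintro ⟨h, h'⟩
    rw [segment_symm] at h
    exact eq_of_mem_segment_of_le le_rfl h₁ h (ge_of_mem_segment le_rfl h₂.le h')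
  · rintro rfl
    exact ⟨right_mem_segment _ _ _, left_mem_segment _ _ _⟩

theorem simplePolyline_of_lt (φ : Pt →ₗ[ℝ] ℝ) {a b c d : Pt} (h₁ : φ a < φ b)
    (h₂ : φ b < φ c) (h₃ : φ c < φ d) : SimplePolyline [a, b, c, d] := by
  have ne : ∀ {x y : Pt}, φ x < φ y → x ≠ y := fun h e => h.ne (congrArg φ e)
  refine ⟨?_, ?_⟩
  · change List.IsChain _ _
    simp [ne h₁, ne h₂, ne h₃]
  · intro i j hi hj hij
    simp only [List.length_cons, List.length_nil] at hi hj
    obtain ⟨rfl, rfl⟩ | ⟨rfl, rfl⟩ | ⟨rfl, rfl⟩ :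
        (i = 0 ∧ j = 1) ∨ (i = 1 ∧ j = 2) ∨ (i = 0 ∧ j = 2) := by omega
    · simpa using segment_inter_of_lt h₁ h₂
    · simpa using segment_inter_of_lt h₂ h₃
    · simp only [List.get_eq_getElem, List.getElem_cons_zero, List.getElem_cons_succ,
        OfNat.ofNat_ne_one, if_false, zero_add, Nat.reduceAdd]
      refine Set.eq_empty_iff_forall_notMem.2 fun x hx => ?_
      have a1 := le_of_mem_segment h₁.le le_rfl hx.1
      have a2 := ge_of_mem_segment le_rfl h₃.le hx.2
      linarith

theorem simplePolyline_of_gt (φ : Pt →ₗ[ℝ] ℝ) {a b c d : Pt} (h₁ : φ b < φ a)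
    (h₂ : φ c < φ b) (h₃ : φ d < φ c) : SimplePolyline [a, b, c, d] :=
  simplePolyline_of_lt (-φ) (by simpa using h₁) (by simpa using h₂) (by simpa using h₃)

theorem not_coplanar_of_crossAt_ne_zero {a b c : Pt}
    (h : crossAt (projPlane a) (projPlane b) (projPlane c) ≠ 0) :
    ¬ Coplanar ℝ (zRay a ∪ zRay b ∪ zRay c) := by
  intro hcop
  rw [coplanar_iff_finrank_le_two] at hcop
  set s := zRay a ∪ zRay b ∪ zRay c
  have ha : ∀ t : ℝ, 0 < t → a + t • zDir ∈ s := fun t ht => Or.inl (Or.inl ⟨t, ht, rfl⟩)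
  have hb : ∀ t : ℝ, 0 < t → b + t • zDir ∈ s := fun t ht => Or.inl (Or.inr ⟨t, ht, rfl⟩)
  have hc : ∀ t : ℝ, 0 < t → c + t • zDir ∈ s := fun t ht => Or.inr ⟨t, ht, rfl⟩
  let v : Fin 3 → Pt := ![b - a, c - a, zDir]
  have hv : ∀ i, v i ∈ vectorSpan ℝ s := by
    intro i
    fin_cases i
    · have := vsub_mem_vectorSpan ℝ (hb 1 one_pos) (ha 1 one_pos)
      simpa [v] using this
    · have := vsub_mem_vectorSpan ℝ (hc 1 one_pos) (ha 1 one_pos)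
      simpa [v] using this
    · have := vsub_mem_vectorSpan ℝ (ha 2 two_pos) (ha 1 one_pos)
      have e : a + (2 : ℝ) • zDir -ᵥ (a + (1 : ℝ) • zDir) = zDir := by
        simp [two_smul]
      rw [e] at this
      exact this
  have hli : LinearIndependent ℝ v := by
    rw [Fintype.linearIndependent_iff]
    intro g hg
    simp only [Fin.sum_univ_three, v, Matrix.cons_val_zero, Matrix.cons_val_one,
      Matrix.cons_val] at hg
    have e₁ := congrArg (fun x => (projPlane x).re) hg
    have e₂ := congrArg (fun x => (projPlane x).im) hg
    have e₃ := congrArg height hg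
    simp at e₁ e₂ e₃
    simp only [crossAt, Complex.sub_re, Complex.sub_im] at h
    have h0 : g 0 = 0 := by
      apply mul_right_cancel₀ h
      rw [zero_mul]
      linear_combination ((projPlane c).im - (projPlane a).im) * e₁
        - ((projPlane c).re - (projPlane a).re) * e₂
    have h1 : g 1 = 0 := by
      apply mul_right_cancel₀ h
      rw [zero_mul]
      linear_combination -((projPlane b).im - (projPlane a).im) * e₁
        + ((projPlane b).re - (projPlane a).re) * e₂
    have h2 : g 2 = 0 := by
      rw [h0, h1] at e₃
      linarith
    intro i
    fin_cases i <;> assumption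
  have := finrank_span_eq_card hli
  have hle : Submodule.span ℝ (Set.range v) ≤ vectorSpan ℝ s := by
    rw [Submodule.span_le]
    rintro _ ⟨i, rfl⟩
    exact hv i
  have := Submodule.finrank_mono hle
  simp only [Fintype.card_fin] at *
  omega

theorem two_pi_div_three_le_angle_down {t r : ℝ} {w : ℂ} (ht : 0 < t) (hr : 0 < r)
    (hw : ‖w‖ ^ 2 = 3 * r ^ 2) : 2 * Real.pi / 3 ≤ angle (liftPt 0 (-t)) (liftPt w r) := by
  have h₁ : ‖liftPt 0 (-t)‖ = t := norm_eq_of_proj_height ht.le (by simp)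
  have h₂ : ‖liftPt w r‖ = 2 * r :=
    norm_eq_of_proj_height (by linarith) (by simp only [projPlane_liftPt, height_liftPt]; linarith)
  refine two_pi_div_three_le_angle ?_ ?_ ?_
  · rw [← norm_pos_iff, h₁]; exact ht
  · rw [← norm_pos_iff, h₂]; linarith
  · rw [h₁, h₂, inner_eq_proj_add_height]
    simp only [projPlane_liftPt, height_liftPt, inner_zero_left]
    linarith

theorem neg_liftPt (w : ℂ) (z : ℝ) : -liftPt w z = liftPt (-w) (-z) :=
  pt_ext (by simp) (by simp)

theorem two_pi_div_three_le_angle_up {t r : ℝ} {w : ℂ} (ht : 0 < t) (hr : 0 < r)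
    (hw : ‖w‖ ^ 2 = 3 * r ^ 2) : 2 * Real.pi / 3 ≤ angle (liftPt 0 t) (liftPt w (-r)) := by
  have := two_pi_div_three_le_angle_down (w := -w) ht hr (by rwa [norm_neg])
  rw [← angle_neg_neg, neg_liftPt, neg_liftPt, neg_neg, neg_neg, neg_zero] at this
  exact this

theorem zDir_eq_liftPt : zDir = liftPt 0 1 := pt_ext (by simp) (by simp)

/-- The height of a drawing of a finite graph is bounded. -/
theorem exists_height_bound {W : Type*} [Finite W] {H : SimpleGraph W}
    (D : PolylineDrawing H) : ∃ M, ∀ x ∈ drawingImage D, height x ≤ M := by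
  have : BddAbove (height '' drawingImage D) := by
    simp only [drawingImage, polyImage, Set.image_union, Set.image_iUnion]
    refine ((Set.finite_range _).image _).bddAbove.union ?_
    have iUnion_bdd : ∀ s : W → Set ℝ, (∀ i, BddAbove (s i)) → BddAbove (⋃ i, s i) :=
      fun s hs => by
      rw [← Set.biUnion_univ]
      exact (Set.Finite.bddAbove_biUnion Set.finite_univ).2 fun i _ => hs i
    refine iUnion_bdd _ fun u => iUnion_bdd _ fun v => ?_
    by_cases h : H.Adj u v
    swap
    · simp [h]
    simp only [h, Set.iUnion_true]
    refine (Set.Finite.bddAbove_biUnion (List.finite_toSet _)).2 fun q _ =>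
      ⟨max (height q.1) (height q.2), ?_⟩
    rintro _ ⟨x, hx, rfl⟩
    exact le_of_mem_segment (le_max_left _ _) (le_max_right _ _) hx
  obtain ⟨M, hM⟩ := this
  exact ⟨M, fun x hx => hM ⟨x, hx, rfl⟩⟩

/-- A family of paths for the edges of a graph in which each edge has an essentially unique
path, possibly given in one orientation only. -/
structure PathSystem {W : Type*} (H : SimpleGraph W) (p : W → Pt)
    (B : W → W → List Pt → Prop) : Prop where
  inj : Function.Injective p
  exists_path : ∀ u v, H.Adj u v → ∃ l, B u v l ∨ B v u l.reverse
  unique : ∀ u v l l', B u v l → B u v l' → l = l'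
  unique_reverse : ∀ u v l l', B u v l → B v u l' → l' = l.reverse
  head : ∀ u v l, B u v l → l.head? = some (p u)
  last : ∀ u v l, B u v l → l.getLast? = some (p v)

theorem PathSystem.exists_drawing {W : Type*} {H : SimpleGraph W} {p : W → Pt}
    {B : W → W → List Pt → Prop} (P : PathSystem H p B) :
    ∃ D : PolylineDrawing H, D.p = p ∧
      ∀ u v h, B u v (D.seq u v h) ∨ B v u (D.seq u v h).reverse := by
  choose seq hseq using P.exists_path
  have uniq : ∀ u v l l', (B u v l ∨ B v u l.reverse) → (B u v l' ∨ B v u l'.reverse) →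
      l = l' := by
    rintro u v l l' (h | h) (h' | h')
    · exact P.unique _ _ _ _ h h'
    · exact List.reverse_injective (P.unique_reverse _ _ _ _ h h').symm
    · exact List.reverse_injective (P.unique_reverse _ _ _ _ h' h)
    · exact List.reverse_injective (P.unique _ _ _ _ h h')
  refine ⟨{ p := p, p_inj := P.inj, seq := seq, seq_head := ?_, seq_last := ?_,
            seq_symm := ?_ }, rfl, hseq⟩
  · intro u v h
    rcases hseq u v h with h | h
    · exact P.head _ _ _ h
    · simpa using P.last _ _ _ h
  · intro u v h
    rcases hseq u v h with h | h
    · exact P.last _ _ _ h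
    · simpa using P.head _ _ _ h
  · intro u v h
    refine uniq v u _ _ (hseq v u h.symm) ?_
    rw [List.reverse_reverse]
    exact (hseq u v h).symm

/-- The vertical projections of the extension rays of a drawing. -/
def rayShadows {V : Type*} (G : SimpleGraph V) {S : Set V}
    (D : PolylineDrawing (G.induce S)) : Set ℂ :=
  (fun v : S => projPlane (D.p v)) '' {v | ∃ w, w ∉ S ∧ G.Adj (v : V) w}

/-- The data used to add a cycle `f` to a vertically extensible drawing `D`: the neighbors
`s` in `S` of cycle vertices, a polygon above which the cycle is placed, the height `z` of
the bends of the cycle, and the heights `h` and `g` of the bends of the edges joining the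
cycle to `S`. -/
structure CycleExtension {V : Type*} (G : SimpleGraph V) (S : Set V)
    (D : PolylineDrawing (G.induce S)) (n : ℕ) (f : ZMod n → V) where
  ext : IsVertExtensible G S D
  le_n : 4 ≤ n
  f_inj : Function.Injective f
  f_notMem : ∀ i, f i ∉ S
  f_adj : ∀ i, G.Adj (f i) (f (i + 1))
  chordless : ∀ i j, G.Adj (f i) (f j) → j = i + 1 ∨ i = j + 1
  third_unique : ∀ i w w', G.Adj (f i) w → G.Adj (f i) w' → w ∉ Set.range f →
    w' ∉ Set.range f → w = w'
  s : {i // ∃ v : S, G.Adj (f i) v} → S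
  s_adj : ∀ j, G.Adj (f j.1) (s j)
  Q : CyclePolygon n (rayShadows G D)
  z : ℝ
  h : {i // ∃ v : S, G.Adj (f i) v} → ℝ
  g : {i // ∃ v : S, G.Adj (f i) v} → ℝ
  g_eq : ∀ j, g j = h j + ‖Q.P j.1 - projPlane (D.p (s j))‖ / √3
  height_lt_h : ∀ x ∈ drawingImage D, ∀ j, height x < h j
  height_lt_z : ∀ x ∈ drawingImage D, height x < z - 1
  g_lt_z : ∀ j, g j < z - 1
  disjoint_heights : ∀ j k, j ≠ k → g j < h k ∨ g k < h j

theorem exists_cycleExtension {V : Type*} [Fintype V] [DecidableEq V] (G : SimpleGraph V)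
    [DecidableRel G.Adj] (hdeg : ∀ v, G.degree v ≤ 3) (S : Set V)
    (D : PolylineDrawing (G.induce S)) (hD : IsVertExtensible G S D)
    (n : ℕ) (hn : 4 ≤ n) (f : ZMod n → V) (hf : Function.Injective f)
    (hdisj : ∀ i : ZMod n, f i ∉ S)
    (hcyc : ∀ i : ZMod n, G.Adj (f i) (f (i + 1)))
    (hchordless : ∀ i j : ZMod n, G.Adj (f i) (f j) → j = i + 1 ∨ i = j + 1) :
    Nonempty (CycleExtension G S D n f) := by
  have : NeZero n := ⟨by omega⟩
  have : Fact (1 < n) := ⟨by omega⟩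
  obtain ⟨Q⟩ := exists_cyclePolygon hn (X := rayShadows G D) ((Set.toFinite _).image _)
  obtain ⟨M, hM⟩ := exists_height_bound D
  choose s hs using fun j : {i // ∃ v : S, G.Adj (f i) v} => j.2
  let δ : {i // ∃ v : S, G.Adj (f i) v} → ℝ :=
    fun j => ‖Q.P j.1 - projPlane (D.p (s j))‖ / √3
  obtain ⟨T, hT0, hT⟩ : ∃ T : ℝ, 0 ≤ T ∧ ∀ j, δ j ≤ T := by
    obtain ⟨T, hT⟩ := (Set.finite_range δ).bddAbove
    exact ⟨max T 0, le_max_right _ _, fun j => (hT ⟨j, rfl⟩).trans (le_max_left _ _)⟩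
  let h : {i // ∃ v : S, G.Adj (f i) v} → ℝ := fun j => M + 1 + j.1.val * (T + 1)
  have key : ∀ j k, j.1.val < k.1.val → h j + δ j < h k := fun j k hjk => by
    have : (j.1.val : ℝ) + 1 ≤ k.1.val := by exact_mod_cast hjk
    have := mul_le_mul_of_nonneg_right this (by linarith : 0 ≤ T + 1)
    have := hT j
    simp only [h]
    linarith
  refine ⟨{
    ext := hD, le_n := hn, f_inj := hf, f_notMem := hdisj, f_adj := hcyc
    chordless := hchordless
    third_unique := fun i w w' hw hw' hwf hwf' => ?_
    s := s, s_adj := hs, Q := Q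
    z := M + 2 + n * (T + 1)
    h := h, g := fun j => h j + δ j, g_eq := fun j => rfl
    height_lt_h := fun x hx j => ?_
    height_lt_z := fun x hx => ?_
    g_lt_z := fun j => ?_
    disjoint_heights := fun j k hjk => ?_ }⟩
  · by_contra hne
    have hprev : G.Adj (f i) (f (i - 1)) := by
      have := hcyc (i - 1)
      rw [sub_add_cancel] at this
      exact this.symm
    have h2 : i + 1 ≠ i - 1 := fun h => by
      have h2 : ((2 : ℕ) : ZMod n) = 0 := by
        push_cast
        linear_combination h
      have := Nat.le_of_dvd (by norm_num) ((ZMod.natCast_eq_zero_iff 2 n).1 h2)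
      omega
    have hsub : ({f (i + 1), f (i - 1), w, w'} : Finset V) ⊆ G.neighborFinset (f i) := by
      intro y hy
      simp only [Finset.mem_insert, Finset.mem_singleton] at hy
      rw [SimpleGraph.mem_neighborFinset]
      rcases hy with rfl | rfl | rfl | rfl <;> simp_all
    have hcard : ({f (i + 1), f (i - 1), w, w'} : Finset V).card = 4 := by
      have a : ∀ k, f k ≠ w := fun k e => hwf ⟨k, e⟩
      have b : ∀ k, f k ≠ w' := fun k e => hwf' ⟨k, e⟩
      rw [Finset.card_insert_of_notMem, Finset.card_insert_of_notMem,
        Finset.card_pair hne] <;> simp [a, b, hf.ne h2]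
    have := Finset.card_le_card hsub
    rw [hcard, SimpleGraph.card_neighborFinset_eq_degree] at this
    have := hdeg (f i)
    omega
  · have := hM x hx
    have : 0 ≤ (j.1.val : ℝ) * (T + 1) := by positivity
    simp only [h]
    linarith
  · have := hM x hx
    have : 0 ≤ (n : ℝ) * (T + 1) := by positivity
    linarith
  · have : (j.1.val : ℝ) + 1 ≤ n := by exact_mod_cast ZMod.val_lt j.1
    have := mul_le_mul_of_nonneg_right this (by linarith : 0 ≤ T + 1)
    have := hT j
    simp only [h]
    linarith
  · have hne : j.1.val ≠ k.1.val := fun e => hjk (Subtype.ext (ZMod.val_injective n e))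
    rcases lt_or_gt_of_ne hne with e | e
    · exact Or.inl (key j k e)
    · exact Or.inr (key k j e)

theorem mem_rayShadows {V : Type*} {G : SimpleGraph V} {S : Set V}
    (D : PolylineDrawing (G.induce S)) {v : S} (hv : ∃ w, w ∉ S ∧ G.Adj (v : V) w) :
    projPlane (D.p v) ∈ rayShadows G D := ⟨v, hv, rfl⟩

theorem p_mem_drawingImage {W : Type*} {H : SimpleGraph W} (D : PolylineDrawing H) (v : W) :
    D.p v ∈ drawingImage D := Or.inl ⟨v, rfl⟩

theorem polyImage_seq_subset {W : Type*} {H : SimpleGraph W} (D : PolylineDrawing H) {u v : W}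
    (h : H.Adj u v) : polyImage (D.seq u v h) ⊆ drawingImage D := fun _ hx =>
  Or.inr (Set.mem_iUnion.2 ⟨u, Set.mem_iUnion.2 ⟨v, Set.mem_iUnion.2 ⟨h, hx⟩⟩⟩)

namespace CycleExtension

variable {V : Type*} {G : SimpleGraph V} {S : Set V} {D : PolylineDrawing (G.induce S)}
  {n : ℕ} {f : ZMod n → V} (E : CycleExtension G S D n f)

include E

theorem succ_ne (i : ZMod n) : i + 1 ≠ i := by
  have : Fact (1 < n) := ⟨by have := E.le_n; omega⟩
  simp

theorem two_ne_zero : (2 : ZMod n) ≠ 0 := fun h => by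
  have h2 : ((2 : ℕ) : ZMod n) = 0 := by exact_mod_cast h
  have := Nat.le_of_dvd (by norm_num) ((ZMod.natCast_eq_zero_iff 2 n).1 h2)
  have := E.le_n
  omega

theorem s_free (j : {i // ∃ v : S, G.Adj (f i) v}) :
    ∃ w, w ∉ S ∧ G.Adj (E.s j : V) w :=
  ⟨f j.1, E.f_notMem _, (E.s_adj j).symm⟩

theorem eq_of_shadow_eq {v w : S} (hv : ∃ x, x ∉ S ∧ G.Adj (v : V) x)
    (hw : ∃ x, x ∉ S ∧ G.Adj (w : V) x)
    (h : projPlane (D.p v) = projPlane (D.p w)) : v = w := by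
  rcases lt_trichotomy (height (D.p v)) (height (D.p w)) with h' | h' | h'
  · have : D.p w ∈ zRay (D.p v) ∩ drawingImage D :=
      ⟨mem_zRay_iff.2 ⟨h.symm, h'⟩, p_mem_drawingImage D w⟩
    rw [E.ext.ray_clear v hv] at this
    exact this.elim
  · exact D.p_inj (pt_ext h h')
  · have : D.p v ∈ zRay (D.p w) ∩ drawingImage D :=
      ⟨mem_zRay_iff.2 ⟨h, h'⟩, p_mem_drawingImage D v⟩
    rw [E.ext.ray_clear w hw] at this
    exact this.elim

theorem s_eq {j : {i // ∃ v : S, G.Adj (f i) v}} {w : V} (hw : w ∉ S)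
    (h : G.Adj (E.s j : V) w) : w = f j.1 :=
  E.ext.out_unique (E.s j) _ _ hw (E.f_notMem _) h (E.s_adj j).symm

theorem s_inj {j k : {i // ∃ v : S, G.Adj (f i) v}} (h : E.s j = E.s k) : j = k := by
  have := E.s_adj k
  rw [← h] at this
  exact Subtype.ext (E.f_inj (E.s_eq (E.f_notMem _) this.symm)).symm

theorem eq_s {i : ZMod n} {v : S} (h : G.Adj (f i) v) (hi : ∃ v : S, G.Adj (f i) v) :
    v = E.s ⟨i, hi⟩ := by
  have hS : ∀ v : S, (v : V) ∉ Set.range f := by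
    rintro v ⟨k, hk⟩
    exact E.f_notMem k (hk ▸ v.2)
  exact Subtype.ext (E.third_unique i _ _ h (E.s_adj ⟨i, hi⟩) (hS _) (hS _))

theorem shadow_ne_P {x : ℂ} (hx : x ∈ rayShadows G D) (i : ZMod n) : x ≠ E.Q.P i := by
  rintro rfl
  exact E.Q.X_P_P _ hx i (i + 1) (E.succ_ne i).symm (by simp [crossAt])

theorem shadow_notMem {v : S} (hv : ∃ x, x ∉ S ∧ G.Adj (v : V) x)
    (j : {i // ∃ v : S, G.Adj (f i) v}) (h : v ≠ E.s j) :
    projPlane (D.p v) ∉ segment ℝ (projPlane (D.p (E.s j))) (E.Q.P j.1) := fun hm =>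
  E.Q.X_X_P _ (mem_rayShadows D hv) _ (mem_rayShadows D (E.s_free j))
    (fun e => h (E.eq_of_shadow_eq hv (E.s_free j) e)) j.1 (crossAt_of_mem_segment hm)

theorem P_notMem (j : {i // ∃ v : S, G.Adj (f i) v}) {k : ZMod n} (h : j.1 ≠ k) :
    E.Q.P k ∉ segment ℝ (projPlane (D.p (E.s j))) (E.Q.P j.1) := fun hm => by
  refine E.Q.X_P_P _ (mem_rayShadows D (E.s_free j)) j.1 k h ?_
  rw [crossAt_rotate]
  exact crossAt_of_mem_segment hm

/-- The position of the `i`th cycle vertex relative to the level `z`: below if and only if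
it has a neighbor in `S`. -/
def side (_ : CycleExtension G S D n f) (i : ZMod n) : ℝ :=
  open Classical in if ∃ v : S, G.Adj (f i) v then -1 else 1

theorem side_down (j : {i // ∃ v : S, G.Adj (f i) v}) : E.side j.1 = -1 := if_pos j.2

theorem side_cases (i : ZMod n) :
    ((∃ v : S, G.Adj (f i) v) ∧ E.side i = -1) ∨
      (¬ (∃ v : S, G.Adj (f i) v) ∧ E.side i = 1) := by
  unfold side
  split_ifs with h
  · exact Or.inl ⟨h, rfl⟩
  · exact Or.inr ⟨h, rfl⟩

/-- The position of the `i`th cycle vertex. -/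
def c (i : ZMod n) : Pt := liftPt (E.Q.P i) (E.z + E.side i)

/-- The bend after the `i`th cycle vertex. -/
def bendAfter (i : ZMod n) : Pt := liftPt (E.Q.P i + E.Q.d i) E.z

/-- The bend before the `i`th cycle vertex. -/
def bendBefore (i : ZMod n) : Pt := liftPt (E.Q.P i - E.Q.d i) E.z

/-- The path from the `i`th cycle vertex to the next one. -/
def cyc (i : ZMod n) : List Pt :=
  [E.c i, E.bendAfter i, E.bendBefore (i + 1), E.c (i + 1)]

/-- The path from `S` to a cycle vertex. -/
def conn (j : {i // ∃ v : S, G.Adj (f i) v}) : List Pt :=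
  [D.p (E.s j), liftPt (projPlane (D.p (E.s j))) (E.h j), liftPt (E.Q.P j.1) (E.g j),
    E.c j.1]

@[simp] theorem proj_c (i : ZMod n) : projPlane (E.c i) = E.Q.P i := projPlane_liftPt _ _

@[simp] theorem height_c (i : ZMod n) : height (E.c i) = E.z + E.side i := height_liftPt _ _

@[simp] theorem proj_bendAfter (i : ZMod n) :
    projPlane (E.bendAfter i) = E.Q.P i + E.Q.d i := projPlane_liftPt _ _

@[simp] theorem height_bendAfter (i : ZMod n) : height (E.bendAfter i) = E.z :=
  height_liftPt _ _

@[simp] theorem proj_bendBefore (i : ZMod n) :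
    projPlane (E.bendBefore i) = E.Q.P i - E.Q.d i := projPlane_liftPt _ _

@[simp] theorem height_bendBefore (i : ZMod n) : height (E.bendBefore i) = E.z :=
  height_liftPt _ _

theorem height_c_down (j : {i // ∃ v : S, G.Adj (f i) v}) : height (E.c j.1) = E.z - 1 := by
  rw [E.height_c, E.side_down]; ring

theorem height_c_bounds (i : ZMod n) : E.z - 1 ≤ height (E.c i) ∧ height (E.c i) ≤ E.z + 1 := by
  rw [height_c]
  rcases E.side_cases i with ⟨-, h⟩ | ⟨-, h⟩ <;> rw [h] <;> constructor <;> linarith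

theorem c_inj : Function.Injective E.c := fun i j h => E.Q.P_inj (by
  rw [← E.proj_c, ← E.proj_c, h])

theorem height_p_lt_h (j : {i // ∃ v : S, G.Adj (f i) v}) (v : S) :
    height (D.p v) < E.h j := E.height_lt_h _ (p_mem_drawingImage D v) j

theorem shadow_s_ne (j : {i // ∃ v : S, G.Adj (f i) v}) :
    0 < ‖E.Q.P j.1 - projPlane (D.p (E.s j))‖ / √3 :=
  div_pos (norm_pos_iff.2 (sub_ne_zero.2
    (E.shadow_ne_P (mem_rayShadows D (E.s_free j)) j.1).symm)) (by positivity)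

theorem h_lt_g (j : {i // ∃ v : S, G.Adj (f i) v}) : E.h j < E.g j := by
  rw [E.g_eq]
  linarith [E.shadow_s_ne j]

/-! ### Points of the new paths -/

theorem conn_cases {j : {i // ∃ v : S, G.Adj (f i) v}} {x : Pt}
    (hx : x ∈ polyImage (E.conn j)) :
    (projPlane x = projPlane (D.p (E.s j)) ∧ (x = D.p (E.s j) ∨ x ∈ zRay (D.p (E.s j)))) ∨
    (projPlane x ∈ segment ℝ (projPlane (D.p (E.s j))) (E.Q.P j.1) ∧ E.h j ≤ height x ∧
      height x ≤ E.g j) ∨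
    (projPlane x = E.Q.P j.1 ∧ E.g j ≤ height x) := by
  have hq := (E.height_p_lt_h j (E.s j)).le
  have hg := E.g_lt_z j
  have hhg := (E.h_lt_g j).le
  rcases mem_polyImage_four.1 hx with h | h | h
  · left
    have h₁ := map_mem_segment projPlane h
    rw [projPlane_liftPt, segment_same] at h₁
    have h₂ := ge_of_mem_segment (φ := height) le_rfl (by simpa using hq) h
    refine ⟨h₁, ?_⟩
    rcases h₂.eq_or_lt with e | e
    · exact Or.inl (pt_ext h₁ e.symm)
    · exact Or.inr (mem_zRay_iff.2 ⟨h₁, e⟩)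
  · right; left
    have h₁ := map_mem_segment projPlane h
    rw [projPlane_liftPt, projPlane_liftPt] at h₁
    exact ⟨h₁, ge_of_mem_segment (by simp) (by simpa using hhg) h,
      le_of_mem_segment (by simpa using hhg) (by simp) h⟩
  · right; right
    have h₁ := map_mem_segment projPlane h
    rw [projPlane_liftPt, E.proj_c, segment_same] at h₁
    refine ⟨h₁, ge_of_mem_segment (by simp) ?_ h⟩
    rw [E.height_c_down]
    exact hg.le

theorem conn_height {j : {i // ∃ v : S, G.Adj (f i) v}} {x : Pt}
    (hx : x ∈ polyImage (E.conn j)) : height x ≤ E.z - 1 :=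
  le_of_mem_polyImage (E.height_lt_z _ (p_mem_drawingImage D _)).le
    (by simpa using ((E.h_lt_g j).trans (E.g_lt_z j)).le) (by simpa using (E.g_lt_z j).le)
    (E.height_c_down j).le hx

theorem conn_top {j : {i // ∃ v : S, G.Adj (f i) v}} {x : Pt}
    (hx : x ∈ polyImage (E.conn j)) (h : E.z - 1 ≤ height x) : x = E.c j.1 := by
  have hq := E.height_lt_z _ (p_mem_drawingImage D (E.s j))
  rcases eq_endpoint_of_le (φ := height) hq.le
    (by simpa using ((E.h_lt_g j).trans (E.g_lt_z j))) (by simpa using E.g_lt_z j)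
    (E.height_c_down j).le hx h with rfl | rfl
  · linarith
  · rfl

theorem conn_old {j : {i // ∃ v : S, G.Adj (f i) v}} {x : Pt}
    (hx : x ∈ polyImage (E.conn j)) (h : x ∈ drawingImage D) : x = D.p (E.s j) := by
  have hh := E.height_lt_h x h j
  have := E.h_lt_g j
  rcases E.conn_cases hx with ⟨-, rfl | h'⟩ | ⟨-, h', -⟩ | ⟨-, h'⟩
  · rfl
  · have : x ∈ zRay (D.p (E.s j)) ∩ drawingImage D := ⟨h', h⟩
    rw [E.ext.ray_clear _ (E.s_free j)] at this
    exact this.elim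
  · linarith
  · linarith

theorem conn_disjoint {j k : {i // ∃ v : S, G.Adj (f i) v}} (hjk : j ≠ k) {x : Pt}
    (hj : x ∈ polyImage (E.conn j)) (hk : x ∈ polyImage (E.conn k)) : False := by
  have hs : E.s j ≠ E.s k := fun e => hjk (E.s_inj e)
  have hi : j.1 ≠ k.1 := fun e => hjk (Subtype.ext e)
  have h₁ : projPlane (D.p (E.s j)) ≠ projPlane (D.p (E.s k)) := fun e =>
    hs (E.eq_of_shadow_eq (E.s_free j) (E.s_free k) e)
  have fj := mem_rayShadows D (E.s_free j)
  have fk := mem_rayShadows D (E.s_free k)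
  rcases E.conn_cases hj with ⟨a, -⟩ | ⟨a, a₁, a₂⟩ | ⟨a, -⟩ <;>
  rcases E.conn_cases hk with ⟨b, -⟩ | ⟨b, b₁, b₂⟩ | ⟨b, -⟩
  · exact h₁ (a.symm.trans b)
  · exact E.shadow_notMem (E.s_free j) k hs (a ▸ b)
  · exact E.shadow_ne_P fj k.1 (a.symm.trans b)
  · exact E.shadow_notMem (E.s_free k) j hs.symm (b ▸ a)
  · rcases E.disjoint_heights j k hjk with h | h <;> linarith
  · exact E.P_notMem j hi (b ▸ a)
  · exact E.shadow_ne_P fk j.1 (b.symm.trans a)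
  · exact E.P_notMem k hi.symm (a ▸ b)
  · exact hi (E.Q.P_inj (a.symm.trans b))

theorem cyc_height {i : ZMod n} {x : Pt} (hx : x ∈ polyImage (E.cyc i)) :
    E.z - 1 ≤ height x ∧ height x ≤ E.z + 1 := by
  constructor
  · exact ge_of_mem_polyImage (E.height_c_bounds _).1 (by simp) (by simp)
      (E.height_c_bounds _).1 hx
  · exact le_of_mem_polyImage (E.height_c_bounds _).2 (by simp) (by simp)
      (E.height_c_bounds _).2 hx

theorem cyc_bottom {i : ZMod n} {x : Pt} (hx : x ∈ polyImage (E.cyc i))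
    (h : height x ≤ E.z - 1) : x = E.c i ∨ x = E.c (i + 1) :=
  eq_endpoint_of_ge (E.height_c_bounds _).1 (by simp) (by simp) (E.height_c_bounds _).1 hx h

theorem m_P_le (i j : ZMod n) : E.Q.m i (E.Q.P j) ≤ E.Q.K i := by
  by_cases h : j = i
  · rw [h, E.Q.m_self]
  by_cases h' : j = i + 1
  · rw [h', E.Q.m_succ]
  exact (E.Q.m_other i j h h').le

theorem cyc_extremal {i : ZMod n} {x : Pt} (hx : x ∈ polyImage (E.cyc i))
    (h : E.Q.m i (projPlane x) ≤ E.Q.K i) : x = E.c i ∨ x = E.c (i + 1) :=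
  eq_endpoint_of_ge (φ := E.Q.m i ∘ₗ projPlane) (by simp [E.Q.m_self])
    (by simpa using E.Q.m_left i) (by simpa using E.Q.m_right i) (by simp [E.Q.m_succ]) hx h

theorem cyc_vertex {i k : ZMod n} (hx : E.c k ∈ polyImage (E.cyc i)) :
    E.c k = E.c i ∨ E.c k = E.c (i + 1) :=
  E.cyc_extremal hx (by rw [E.proj_c]; exact E.m_P_le i k)

theorem cyc_inter {i j : ZMod n} (hij : i ≠ j) {x : Pt} (hi : x ∈ polyImage (E.cyc i))
    (hj : x ∈ polyImage (E.cyc j)) : x = E.c i ∨ x = E.c (i + 1) := by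
  apply E.cyc_extremal hi
  refine le_of_mem_polyImage (φ := E.Q.m i ∘ₗ projPlane) ?_ ?_ ?_ ?_ hj
  · simpa using E.m_P_le i j
  · simpa using (E.Q.m_other_left i j hij.symm).le
  · simpa using (E.Q.m_other_right i (j + 1) fun e => hij (add_right_cancel e).symm).le
  · simpa using E.m_P_le i (j + 1)

theorem shadow_cyc {i : ZMod n} {x : Pt} (hx : x ∈ polyImage (E.cyc i)) :
    projPlane x ∉ rayShadows G D := by
  intro hX
  rcases mem_polyImage_four.1 hx with h | h | h <;>
    have h := crossAt_of_mem_segment (map_mem_segment projPlane h)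
  · rw [E.proj_c, E.proj_bendAfter] at h
    exact E.Q.X_left _ hX _ h
  · rw [E.proj_bendBefore, E.proj_bendAfter] at h
    exact E.Q.X_mid _ hX _ h
  · rw [E.proj_bendBefore, E.proj_c] at h
    exact E.Q.X_right _ hX _ h

/-! ### Simplicity and angles of the new paths -/

theorem conn_simple (j : {i // ∃ v : S, G.Adj (f i) v}) :
    SimplePolyline (E.conn j) ∧ SimplePolyline (E.conn j).reverse := by
  have h₁ := E.height_p_lt_h j (E.s j)
  have h₂ := E.h_lt_g j
  have h₃ := E.g_lt_z j
  have h₄ := E.height_c_down j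
  constructor
  · exact simplePolyline_of_lt height (by simpa using h₁) (by simpa using h₂)
      (by rw [h₄]; simpa using h₃)
  · exact simplePolyline_of_gt height (by rw [h₄]; simpa using h₃) (by simpa using h₂)
      (by simpa using h₁)

theorem cyc_simple (i : ZMod n) :
    SimplePolyline (E.cyc i) ∧ SimplePolyline (E.cyc i).reverse := by
  set u := E.Q.P (i + 1) - E.Q.d (i + 1) - (E.Q.P i + E.Q.d i) with hu
  have hu0 : 0 < ‖u‖ := norm_pos_iff.2 (E.Q.chord_ne i)
  let φ : Pt →ₗ[ℝ] ℝ := (innerₛₗ ℝ u) ∘ₗ projPlane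
  have hφ : ∀ x, φ x = inner ℝ u (projPlane x) := fun _ => rfl
  have a₁ : φ (E.c i) < φ (E.bendAfter i) := by
    have := E.Q.turn_left i
    rw [← hu, real_inner_comm] at this
    rw [hφ, hφ, E.proj_c, E.proj_bendAfter, inner_add_right]
    linarith
  have a₂ : φ (E.bendAfter i) < φ (E.bendBefore (i + 1)) := by
    have : 0 < inner ℝ u u := by rw [real_inner_self_eq_norm_sq]; positivity
    rwa [← sub_pos, ← map_sub, hφ, map_sub, E.proj_bendBefore, E.proj_bendAfter, ← hu]
  have a₃ : φ (E.bendBefore (i + 1)) < φ (E.c (i + 1)) := by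
    have := E.Q.turn_right i
    rw [← hu, real_inner_comm] at this
    rw [hφ, hφ, E.proj_c, E.proj_bendBefore, inner_sub_right]
    linarith
  exact ⟨simplePolyline_of_lt φ a₁ a₂ a₃, simplePolyline_of_gt φ a₃ a₂ a₁⟩

theorem norm_sq_shadow (j : {i // ∃ v : S, G.Adj (f i) v}) :
    ‖E.Q.P j.1 - projPlane (D.p (E.s j))‖ ^ 2 =
      3 * (‖E.Q.P j.1 - projPlane (D.p (E.s j))‖ / √3) ^ 2 := by
  rw [div_pow, Real.sq_sqrt (by norm_num)]
  ring

theorem conn_bends (j : {i // ∃ v : S, G.Adj (f i) v}) {a q b : Pt}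
    (h : [a, q, b] <:+: E.conn j) : 2 * Real.pi / 3 ≤ angle (a - q) (b - q) := by
  have h₁ := E.height_p_lt_h j (E.s j)
  have h₃ := E.g_lt_z j
  have hg : E.g j - E.h j = ‖E.Q.P j.1 - projPlane (D.p (E.s j))‖ / √3 := by
    rw [E.g_eq]; ring
  rcases eq_of_three_consecutive_of_four h with ⟨rfl, rfl, rfl⟩ | ⟨rfl, rfl, rfl⟩
  · have e : D.p (E.s j) - liftPt (projPlane (D.p (E.s j))) (E.h j) =
        liftPt 0 (-(E.h j - height (D.p (E.s j)))) := pt_ext (by simp) (by simp)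
    rw [e, liftPt_sub, hg]
    exact two_pi_div_three_le_angle_down (by linarith) (E.shadow_s_ne j) (E.norm_sq_shadow j)
  · have e : E.c j.1 - liftPt (E.Q.P j.1) (E.g j) = liftPt 0 (E.z - 1 - E.g j) :=
      pt_ext (by simp) (by simp [E.side_down]; ring)
    rw [e, liftPt_sub, angle_comm,
      show E.h j - E.g j = -(‖E.Q.P j.1 - projPlane (D.p (E.s j))‖ / √3) by linarith]
    refine two_pi_div_three_le_angle_up (by linarith) (E.shadow_s_ne j) ?_
    rw [norm_sub_rev]
    exact E.norm_sq_shadow j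

theorem side_sq (i : ZMod n) : E.side i ^ 2 = 1 := by
  rcases E.side_cases i with ⟨-, h⟩ | ⟨-, h⟩ <;> rw [h] <;> norm_num

theorem norm_liftPt_d (i : ZMod n) {t : ℝ} (ht : t ^ 2 = 1) :
    ‖liftPt (E.Q.d i) t‖ = 2 ∧ ‖liftPt (-E.Q.d i) t‖ = 2 := by
  constructor <;> refine norm_eq_of_proj_height (by norm_num) ?_ <;>
    (rw [projPlane_liftPt, height_liftPt, ht]; try rw [norm_neg]) <;>
    rw [E.Q.norm_d, Real.sq_sqrt (by norm_num)] <;> norm_num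

theorem cyc_bends (i : ZMod n) {a q b : Pt}
    (h : [a, q, b] <:+: E.cyc i) : 2 * Real.pi / 3 ≤ angle (a - q) (b - q) := by
  have hu0 : 0 < ‖E.Q.P (i + 1) - E.Q.d (i + 1) - (E.Q.P i + E.Q.d i)‖ :=
    norm_pos_iff.2 (E.Q.chord_ne i)
  have t₁ := E.Q.turn_left i
  have t₂ := E.Q.turn_right i
  have e : E.bendBefore (i + 1) - E.bendAfter i =
      liftPt (E.Q.P (i + 1) - E.Q.d (i + 1) - (E.Q.P i + E.Q.d i)) 0 :=
    pt_ext (by simp) (by simp)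
  set u := E.Q.P (i + 1) - E.Q.d (i + 1) - (E.Q.P i + E.Q.d i) with hu
  have hn : ‖liftPt u 0‖ = ‖u‖ := norm_eq_of_proj_height (norm_nonneg _) (by simp)
  have hn' : ‖liftPt (-u) 0‖ = ‖u‖ := norm_eq_of_proj_height (norm_nonneg _) (by simp)
  rcases eq_of_three_consecutive_of_four h with ⟨rfl, rfl, rfl⟩ | ⟨rfl, rfl, rfl⟩
  · have e' : E.c i - E.bendAfter i = liftPt (-E.Q.d i) (E.side i) :=
      pt_ext (by simp) (by simp)
    have hd := (E.norm_liftPt_d i (E.side_sq i)).2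
    rw [e, e']
    refine two_pi_div_three_le_angle ?_ ?_ ?_
    · rw [← norm_pos_iff, hd]; norm_num
    · rw [← norm_pos_iff, hn]; exact hu0
    · rw [hd, hn, inner_eq_proj_add_height]
      simp only [projPlane_liftPt, height_liftPt, inner_neg_left]
      linarith
  · have e' : E.c (i + 1) - E.bendBefore (i + 1) = liftPt (E.Q.d (i + 1)) (E.side (i + 1)) :=
      pt_ext (by simp) (by simp)
    have hd := (E.norm_liftPt_d (i + 1) (E.side_sq (i + 1))).1
    rw [← neg_sub, e, e', neg_liftPt, neg_zero]
    refine two_pi_div_three_le_angle ?_ ?_ ?_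
    · rw [← norm_pos_iff, hn']; exact hu0
    · rw [← norm_pos_iff, hd]; norm_num
    · rw [hd, hn', inner_eq_proj_add_height]
      simp only [projPlane_liftPt, height_liftPt, inner_neg_left]
      rw [real_inner_comm]
      linarith

theorem bendAfter_sub (i : ZMod n) :
    E.bendAfter i - E.c i = liftPt (E.Q.d i) (-E.side i) := pt_ext (by simp) (by simp)

theorem bendBefore_sub (i : ZMod n) :
    E.bendBefore i - E.c i = liftPt (-E.Q.d i) (-E.side i) := pt_ext (by simp) (by simp)

theorem angle_cycle_cycle (i : ZMod n) :
    2 * Real.pi / 3 ≤ angle (E.bendAfter i - E.c i) (E.bendBefore i - E.c i) := by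
  have hs : (-E.side i) ^ 2 = 1 := by rw [neg_sq, E.side_sq]
  obtain ⟨h₁, h₂⟩ := E.norm_liftPt_d i hs
  rw [bendAfter_sub, bendBefore_sub]
  refine two_pi_div_three_le_angle ?_ ?_ ?_
  · rw [← norm_pos_iff, h₁]; norm_num
  · rw [← norm_pos_iff, h₂]; norm_num
  · rw [h₁, h₂, inner_eq_proj_add_height]
    simp only [projPlane_liftPt, height_liftPt, inner_neg_right]
    rw [real_inner_self_eq_norm_sq, E.Q.norm_d, Real.sq_sqrt (by norm_num)]
    nlinarith

theorem angle_conn_cycle (j : {i // ∃ v : S, G.Adj (f i) v}) {b : Pt}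
    (hb : b = E.bendAfter j.1 ∨ b = E.bendBefore j.1) :
    2 * Real.pi / 3 ≤ angle (liftPt (E.Q.P j.1) (E.g j) - E.c j.1) (b - E.c j.1) := by
  have e : liftPt (E.Q.P j.1) (E.g j) - E.c j.1 = liftPt 0 (-(E.z - 1 - E.g j)) :=
    pt_ext (by simp) (by simp [E.side_down]; ring)
  have hd : ‖E.Q.d j.1‖ ^ 2 = 3 * 1 ^ 2 := by
    rw [E.Q.norm_d, Real.sq_sqrt (by norm_num)]; norm_num
  have hg := E.g_lt_z j
  rw [e]
  rcases hb with rfl | rfl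
  · rw [bendAfter_sub, E.side_down, neg_neg]
    exact two_pi_div_three_le_angle_down (by linarith) one_pos hd
  · rw [bendBefore_sub, E.side_down, neg_neg]
    exact two_pi_div_three_le_angle_down (by linarith) one_pos (by rwa [norm_neg])

theorem angle_ray_cycle {i : ZMod n} (hi : E.side i = 1) {b : Pt}
    (hb : b = E.bendAfter i ∨ b = E.bendBefore i) :
    2 * Real.pi / 3 ≤ angle zDir (b - E.c i) := by
  have hd : ‖E.Q.d i‖ ^ 2 = 3 * 1 ^ 2 := by
    rw [E.Q.norm_d, Real.sq_sqrt (by norm_num)]; norm_num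
  rw [zDir_eq_liftPt]
  rcases hb with rfl | rfl
  · rw [bendAfter_sub, hi]
    exact two_pi_div_three_le_angle_up one_pos one_pos hd
  · rw [bendBefore_sub, hi]
    exact two_pi_div_three_le_angle_up one_pos one_pos (by rwa [norm_neg])

end CycleExtension

/-! ### The extended drawing -/

namespace CycleExtension

variable {V : Type*} {G : SimpleGraph V} {S : Set V} {D : PolylineDrawing (G.induce S)}
  {n : ℕ} {f : ZMod n → V}

/-- The inclusion of the old vertices. -/
def inS (f : ZMod n → V) (v : S) : (S ∪ Set.range f : Set V) := ⟨v, Or.inl v.2⟩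

/-- The inclusion of the cycle vertices. -/
def inC (S : Set V) (f : ZMod n → V) (i : ZMod n) : (S ∪ Set.range f : Set V) :=
  ⟨f i, Or.inr ⟨i, rfl⟩⟩

theorem eq_inS_or_inC (u : (S ∪ Set.range f : Set V)) :
    (∃ v, u = inS f v) ∨ ∃ i, u = inC S f i := by
  rcases u with ⟨u, hu | ⟨i, rfl⟩⟩
  · exact Or.inl ⟨⟨u, hu⟩, rfl⟩
  · exact Or.inr ⟨i, rfl⟩

theorem inS_injective : Function.Injective (inS f : S → _) := fun _ _ h =>
  Subtype.ext (congrArg (fun x : (S ∪ Set.range f : Set V) => (x : V)) h)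

section

variable (E : CycleExtension G S D n f)

include E

theorem inC_injective : Function.Injective (inC S f) := fun _ _ h =>
  E.f_inj (congrArg (fun x : (S ∪ Set.range f : Set V) => (x : V)) h)

theorem inS_ne_inC (v : S) (i : ZMod n) : inS f v ≠ inC S f i := fun h =>
  E.f_notMem i (by
    have e : (v : V) = f i := congrArg (fun x : (S ∪ Set.range f : Set V) => (x : V)) h
    exact e ▸ v.2)

open Classical in
/-- The positions of the vertices in the extended drawing. -/
def pos (v : (S ∪ Set.range f : Set V)) : Pt :=
  if h : (v : V) ∈ S then D.p ⟨v, h⟩ else E.c (Function.invFun f v)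

@[simp] theorem pos_inS (v : S) : E.pos (inS f v) = D.p v := dif_pos v.2

@[simp] theorem pos_inC (i : ZMod n) : E.pos (inC S f i) = E.c i := by
  have h : E.pos (inC S f i) = E.c (Function.invFun f (f i)) := dif_neg (E.f_notMem i)
  rw [h, Function.leftInverse_invFun E.f_inj i]

theorem height_p_lt (v : S) : height (D.p v) < E.z - 1 :=
  E.height_lt_z _ (p_mem_drawingImage D v)

theorem p_ne_c (v : S) (i : ZMod n) : D.p v ≠ E.c i := fun h => by
  have h₁ := E.height_p_lt v
  have h₂ := (E.height_c_bounds i).1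
  rw [h] at h₁
  linarith

theorem pos_injective : Function.Injective E.pos := by
  intro u v h
  rcases eq_inS_or_inC u with ⟨a, rfl⟩ | ⟨i, rfl⟩ <;>
    rcases eq_inS_or_inC v with ⟨b, rfl⟩ | ⟨j, rfl⟩ <;>
    simp only [pos_inS, pos_inC] at h
  · rw [D.p_inj h]
  · exact (E.p_ne_c _ _ h).elim
  · exact (E.p_ne_c _ _ h.symm).elim
  · rw [E.c_inj h]

/-- The paths of the extended drawing, each in one orientation (or, for edges between old
vertices, in both). -/
def IsPath (u v : (S ∪ Set.range f : Set V)) (l : List Pt) : Prop :=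
  (∃ a b h, u = inS f a ∧ v = inS f b ∧ l = D.seq a b h) ∨
  (∃ j, u = inS f (E.s j) ∧ v = inC S f j.1 ∧ l = E.conn j) ∨
  (∃ i, u = inC S f i ∧ v = inC S f (i + 1) ∧ l = E.cyc i)

theorem exists_isPath (u v : (S ∪ Set.range f : Set V))
    (h : (G.induce (S ∪ Set.range f)).Adj u v) :
    ∃ l, E.IsPath u v l ∨ E.IsPath v u l.reverse := by
  rcases eq_inS_or_inC u with ⟨a, rfl⟩ | ⟨i, rfl⟩ <;>
    rcases eq_inS_or_inC v with ⟨b, rfl⟩ | ⟨j, rfl⟩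
  · exact ⟨D.seq a b h, Or.inl (Or.inl ⟨a, b, h, rfl, rfl, rfl⟩)⟩
  · have h' : G.Adj (f j) a := h.symm
    exact ⟨E.conn ⟨j, a, h'⟩, Or.inl (Or.inr (Or.inl ⟨⟨j, a, h'⟩,
      by rw [← E.eq_s h' ⟨a, h'⟩], rfl, rfl⟩))⟩
  · have h' : G.Adj (f i) b := h
    exact ⟨(E.conn ⟨i, b, h'⟩).reverse, Or.inr (Or.inr (Or.inl ⟨⟨i, b, h'⟩,
      by rw [← E.eq_s h' ⟨b, h'⟩], rfl, List.reverse_reverse _⟩))⟩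
  · rcases E.chordless i j h with rfl | rfl
    · exact ⟨_, Or.inl (Or.inr (Or.inr ⟨i, rfl, rfl, rfl⟩))⟩
    · exact ⟨(E.cyc j).reverse, Or.inr (Or.inr (Or.inr ⟨j, rfl, rfl,
        List.reverse_reverse _⟩))⟩

theorem pathSystem : PathSystem (G.induce (S ∪ Set.range f)) E.pos E.IsPath where
  inj := E.pos_injective
  exists_path := E.exists_isPath
  unique := by
    rintro u v l l' (⟨a, b, h, rfl, rfl, rfl⟩ | ⟨j, rfl, rfl, rfl⟩ | ⟨i, rfl, rfl, rfl⟩)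
      (⟨a', b', h', e₁, e₂, rfl⟩ | ⟨j', e₁, e₂, rfl⟩ | ⟨i', e₁, e₂, rfl⟩)
    · obtain rfl := inS_injective e₁
      obtain rfl := inS_injective e₂
      rfl
    · exact (E.inS_ne_inC _ _ e₂).elim
    · exact (E.inS_ne_inC _ _ e₁).elim
    · exact (E.inS_ne_inC _ _ e₂.symm).elim
    · rw [E.s_inj (inS_injective e₁)]
    · exact (E.inS_ne_inC _ _ e₁).elim
    · exact (E.inS_ne_inC _ _ e₁.symm).elim
    · exact (E.inS_ne_inC _ _ e₁.symm).elim
    · rw [E.inC_injective e₁]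
  unique_reverse := by
    rintro u v l l' (⟨a, b, h, rfl, rfl, rfl⟩ | ⟨j, rfl, rfl, rfl⟩ | ⟨i, rfl, rfl, rfl⟩)
      (⟨a', b', h', e₁, e₂, rfl⟩ | ⟨j', e₁, e₂, rfl⟩ | ⟨i', e₁, e₂, rfl⟩)
    · obtain rfl := inS_injective e₁
      obtain rfl := inS_injective e₂
      exact D.seq_symm _ _ _
    · exact (E.inS_ne_inC _ _ e₂).elim
    · exact (E.inS_ne_inC _ _ e₁).elim
    · exact (E.inS_ne_inC _ _ e₁.symm).elim
    · exact (E.inS_ne_inC _ _ e₁.symm).elim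
    · exact (E.inS_ne_inC _ _ e₂).elim
    · exact (E.inS_ne_inC _ _ e₁.symm).elim
    · exact (E.inS_ne_inC _ _ e₁.symm).elim
    · have e₃ := E.inC_injective e₁
      have e₄ := E.inC_injective e₂
      refine (E.two_ne_zero ?_).elim
      linear_combination e₃ - e₄
  head := by
    rintro u v l (⟨a, b, h, rfl, rfl, rfl⟩ | ⟨j, rfl, rfl, rfl⟩ | ⟨i, rfl, rfl, rfl⟩)
    · rw [pos_inS, D.seq_head]
    · rw [pos_inS]; rfl
    · rw [pos_inC]; rfl
  last := by
    rintro u v l (⟨a, b, h, rfl, rfl, rfl⟩ | ⟨j, rfl, rfl, rfl⟩ | ⟨i, rfl, rfl, rfl⟩)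
    · rw [pos_inS, D.seq_last]
    · rw [pos_inC]; rfl
    · rw [pos_inC]; rfl

end

variable {E : CycleExtension G S D n f} {u v u' v' : (S ∪ Set.range f : Set V)}
  {l l' : List Pt}

theorem IsPath.simple (hl : E.IsPath u v l) : SimplePolyline l ∧ SimplePolyline l.reverse := by
  rcases hl with ⟨a, b, h, rfl, rfl, rfl⟩ | ⟨j, rfl, rfl, rfl⟩ | ⟨i, rfl, rfl, rfl⟩
  · exact ⟨E.ext.noncross.1 _ _ _, D.seq_symm _ _ h ▸ E.ext.noncross.1 _ _ _⟩
  · exact E.conn_simple j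
  · exact E.cyc_simple i

theorem IsPath.length_le (hl : E.IsPath u v l) : l.length ≤ 4 := by
  rcases hl with ⟨a, b, h, rfl, rfl, rfl⟩ | ⟨j, rfl, rfl, rfl⟩ | ⟨i, rfl, rfl, rfl⟩
  · exact E.ext.bends _ _ _
  · exact le_rfl
  · exact le_rfl

theorem IsPath.bends (hl : E.IsPath u v l) {a q b : Pt} (h : [a, q, b] <:+: l) :
    2 * Real.pi / 3 ≤ angle (a - q) (b - q) := by
  rcases hl with ⟨_, _, h', rfl, rfl, rfl⟩ | ⟨j, rfl, rfl, rfl⟩ | ⟨i, rfl, rfl, rfl⟩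
  · exact E.ext.res.1 _ _ h' _ _ _ h
  · exact E.conn_bends j h
  · exact E.cyc_bends i h

theorem IsPath.endpoints_mem (hl : E.IsPath u v l) :
    E.pos u ∈ polyImage l ∧ E.pos v ∈ polyImage l := by
  rcases hl with ⟨a, b, h, rfl, rfl, rfl⟩ | ⟨j, rfl, rfl, rfl⟩ | ⟨i, rfl, rfl, rfl⟩
  · have := E.ext.noncross.2.1 a b h
    rw [pos_inS, pos_inS]
    constructor
    · exact (this.ge (Or.inl rfl)).1
    · exact (this.ge (Or.inr rfl)).1
  · rw [pos_inS, pos_inC]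
    exact ⟨mem_polyImage_four.2 (Or.inl (left_mem_segment _ _ _)),
      mem_polyImage_four.2 (Or.inr (Or.inr (right_mem_segment _ _ _)))⟩
  · rw [pos_inC, pos_inC]
    exact ⟨mem_polyImage_four.2 (Or.inl (left_mem_segment _ _ _)),
      mem_polyImage_four.2 (Or.inr (Or.inr (right_mem_segment _ _ _)))⟩

theorem IsPath.eq_of_vertex_mem (hl : E.IsPath u v l) {w : (S ∪ Set.range f : Set V)}
    (hw : E.pos w ∈ polyImage l) : w = u ∨ w = v := by
  suffices E.pos w = E.pos u ∨ E.pos w = E.pos v from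
    this.imp (fun h => E.pos_injective h) (fun h => E.pos_injective h)
  rcases eq_inS_or_inC w with ⟨b, rfl⟩ | ⟨k, rfl⟩ <;>
    rcases hl with ⟨a, b, h, rfl, rfl, rfl⟩ | ⟨j, rfl, rfl, rfl⟩ | ⟨i, rfl, rfl, rfl⟩ <;>
    simp only [pos_inS, pos_inC] at hw ⊢
  · exact (E.ext.noncross.2.1 a _ h).le ⟨hw, _, rfl⟩
  · exact Or.inl (E.conn_old hw (p_mem_drawingImage D _))
  · linarith [(E.cyc_height hw).1, E.height_p_lt b]
  · linarith [E.height_lt_z _ (polyImage_seq_subset D h hw), (E.height_c_bounds k).1]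
  · exact Or.inr (E.conn_top hw (E.height_c_bounds k).1)
  · exact E.cyc_vertex hw

theorem IsPath.eq_of_mem_inter (hl : E.IsPath u v l) (hl' : E.IsPath u' v' l')
    (hne : s(u, v) ≠ s(u', v')) {x : Pt} (hx : x ∈ polyImage l) (hx' : x ∈ polyImage l') :
    x = E.pos u ∨ x = E.pos v := by
  rcases hl with ⟨a, b, h, rfl, rfl, rfl⟩ | ⟨j, rfl, rfl, rfl⟩ | ⟨i, rfl, rfl, rfl⟩ <;>
    rcases hl' with ⟨a', b', h', rfl, rfl, rfl⟩ | ⟨j', rfl, rfl, rfl⟩ | ⟨i', rfl, rfl, rfl⟩ <;>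
    simp only [pos_inS, pos_inC]
  · have hne' : s(a, b) ≠ s(a', b') := fun e => hne (congrArg (Sym2.map (inS f)) e)
    obtain ⟨y, ⟨hy, -⟩, rfl⟩ := (E.ext.noncross.2.2 a b a' b' h h' hne').le ⟨hx, hx'⟩
    exact hy.imp (fun e => congrArg D.p e) (fun e => congrArg D.p e)
  · obtain rfl := E.conn_old hx' (polyImage_seq_subset D h hx)
    exact (E.ext.noncross.2.1 a b h).le ⟨hx, _, rfl⟩
  · linarith [E.height_lt_z _ (polyImage_seq_subset D h hx), (E.cyc_height hx').1]
  · exact Or.inl (E.conn_old hx (polyImage_seq_subset D h' hx'))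
  · refine (E.conn_disjoint (fun e => hne ?_) hx hx').elim
    rw [e]
  · exact Or.inr (E.conn_top hx (E.cyc_height hx').1)
  · linarith [E.height_lt_z _ (polyImage_seq_subset D h' hx'), (E.cyc_height hx).1]
  · exact E.cyc_bottom hx (E.conn_height hx')
  · refine E.cyc_inter (fun e => hne ?_) hx hx'
    rw [e]

theorem IsPath.start_inS {a : S} {w : (S ∪ Set.range f : Set V)} {x : Pt}
    (hl : E.IsPath (inS f a) w l ∨ E.IsPath w (inS f a) l.reverse) (hx : l[1]? = some x) :
    (∃ b h, w = inS f b ∧ (D.seq a b h)[1]? = some x) ∨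
      ∃ j, a = E.s j ∧ w = inC S f j.1 ∧ x = liftPt (projPlane (D.p (E.s j))) (E.h j) := by
  rcases hl with (⟨a', b, h, e, rfl, rfl⟩ | ⟨j, e, rfl, rfl⟩ | ⟨i, e, rfl, rfl⟩) |
    (⟨b, a', h, rfl, e, e'⟩ | ⟨j, rfl, e, e'⟩ | ⟨i, rfl, e, e'⟩)
  · obtain rfl := inS_injective e
    exact Or.inl ⟨b, h, rfl, hx⟩
  · obtain rfl := inS_injective e
    exact Or.inr ⟨j, rfl, rfl, (Option.some_injective _ hx).symm⟩
  · exact (E.inS_ne_inC _ _ e).elim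
  · obtain rfl := inS_injective e
    refine Or.inl ⟨b, h.symm, rfl, ?_⟩
    rw [D.seq_symm _ _ h, ← e', List.reverse_reverse]
    exact hx
  · exact (E.inS_ne_inC _ _ e).elim
  · exact (E.inS_ne_inC _ _ e).elim

theorem IsPath.start_inC {i : ZMod n} {w : (S ∪ Set.range f : Set V)} {x : Pt}
    (hl : E.IsPath (inC S f i) w l ∨ E.IsPath w (inC S f i) l.reverse)
    (hx : l[1]? = some x) :
    (w = inC S f (i + 1) ∧ x = E.bendAfter i) ∨ (w = inC S f (i - 1) ∧ x = E.bendBefore i) ∨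
      ∃ j, j.1 = i ∧ w = inS f (E.s j) ∧ x = liftPt (E.Q.P j.1) (E.g j) := by
  rcases hl with (⟨a', b, h, e, rfl, rfl⟩ | ⟨j, e, rfl, rfl⟩ | ⟨k, e, rfl, rfl⟩) |
    (⟨b, a', h, rfl, e, e'⟩ | ⟨j, rfl, e, e'⟩ | ⟨k, rfl, e, e'⟩)
  · exact (E.inS_ne_inC _ _ e.symm).elim
  · exact (E.inS_ne_inC _ _ e.symm).elim
  · obtain rfl := E.inC_injective e
    exact Or.inl ⟨rfl, (Option.some_injective _ hx).symm⟩
  · exact (E.inS_ne_inC _ _ e.symm).elim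
  · obtain rfl := E.inC_injective e
    obtain rfl := List.reverse_eq_iff.1 e'
    exact Or.inr (Or.inr ⟨j, rfl, rfl, (Option.some_injective _ hx).symm⟩)
  · obtain rfl := E.inC_injective e
    obtain rfl := List.reverse_eq_iff.1 e'
    refine Or.inr (Or.inl ⟨?_, (Option.some_injective _ hx).symm⟩)
    rw [add_sub_cancel_right]

variable (E)

/-- A drawing made of the paths of the extension. -/
structure IsExtended (D' : PolylineDrawing (G.induce (S ∪ Set.range f))) : Prop where
  p_eq : D'.p = E.pos
  seq_isPath : ∀ u v h, E.IsPath u v (D'.seq u v h) ∨ E.IsPath v u (D'.seq u v h).reverse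

theorem exists_isExtended : ∃ D', E.IsExtended D' := by
  obtain ⟨D', h₁, h₂⟩ := E.pathSystem.exists_drawing
  exact ⟨D', h₁, h₂⟩

variable {E} {D' : PolylineDrawing (G.induce (S ∪ Set.range f))}

theorem IsExtended.exists_isPath (H : E.IsExtended D') (u v h) :
    ∃ u' v' l, E.IsPath u' v' l ∧ ({u', v'} : Set (S ∪ Set.range f : Set V)) = {u, v} ∧
      s(u', v') = s(u, v) ∧ polyImage (D'.seq u v h) = polyImage l := by
  rcases H.seq_isPath u v h with h' | h'
  · exact ⟨u, v, _, h', rfl, rfl, rfl⟩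
  · exact ⟨v, u, _, h', Set.pair_comm _ _, Sym2.eq_swap, (polyImage_reverse _).symm⟩

theorem IsExtended.nonCrossing (H : E.IsExtended D') : NonCrossing D' := by
  refine ⟨fun u v h => ?_, fun u v h => ?_, fun u v u' v' h h' hne => ?_⟩
  · rcases H.seq_isPath u v h with h' | h'
    · exact h'.simple.1
    · rw [← List.reverse_reverse (D'.seq u v h)]
      exact h'.simple.2
  · obtain ⟨a, b, l, hl, e, -, e'⟩ := H.exists_isPath u v h
    rw [e', ← Set.image_pair, ← e, H.p_eq]
    ext x
    constructor
    · rintro ⟨hx, w, rfl⟩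
      exact ⟨w, hl.eq_of_vertex_mem hx, rfl⟩
    · rintro ⟨w, rfl | rfl, rfl⟩
      · exact ⟨hl.endpoints_mem.1, _, rfl⟩
      · exact ⟨hl.endpoints_mem.2, _, rfl⟩
  · obtain ⟨a, b, l, hl, e₁, e₂, e₃⟩ := H.exists_isPath u v h
    obtain ⟨a', b', l', hl', e₁', e₂', e₃'⟩ := H.exists_isPath u' v' h'
    rw [← e₂, ← e₂'] at hne
    rw [e₃, e₃', ← e₁, ← e₁', H.p_eq, Set.image_inter E.pos_injective, Set.image_pair,
      Set.image_pair]
    ext x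
    constructor
    · rintro ⟨hx, hx'⟩
      exact ⟨hl.eq_of_mem_inter hl' hne hx hx', hl'.eq_of_mem_inter hl hne.symm hx' hx⟩
    · rintro ⟨hx, hx'⟩
      constructor
      · rcases hx with rfl | rfl
        exacts [hl.endpoints_mem.1, hl.endpoints_mem.2]
      · rcases hx' with rfl | rfl
        exacts [hl'.endpoints_mem.1, hl'.endpoints_mem.2]

theorem IsExtended.maxBends (H : E.IsExtended D') : MaxBends D' 2 := by
  intro u v h
  rcases H.seq_isPath u v h with h' | h'
  · exact h'.length_le
  · simpa using h'.length_le

theorem angle_conn_old {j : {i // ∃ v : S, G.Adj (f i) v}} {b : S}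
    {h : (G.induce S).Adj (E.s j) b} {x : Pt} (hx : (D.seq (E.s j) b h)[1]? = some x) :
    2 * Real.pi / 3 ≤ angle (liftPt (projPlane (D.p (E.s j))) (E.h j) - D.p (E.s j))
      (x - D.p (E.s j)) := by
  rw [liftPt_sub_eq_smul_zDir, angle_eq_of_smul_zDir (sub_pos.2 (E.height_p_lt_h j _))]
  exact E.ext.ray_angle _ (E.s_free j) b h x hx

theorem IsExtended.angularRes (H : E.IsExtended D') :
    AngularResAtLeast D' (2 * Real.pi / 3) := by
  refine ⟨fun u v h a q b hq => ?_, fun v u w hu hw hne a b ha hb => ?_⟩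
  · rcases H.seq_isPath u v h with h' | h'
    · exact h'.bends hq
    · rw [angle_comm]
      exact h'.bends hq.reverse
  have hu := H.seq_isPath v u hu
  have hw := H.seq_isPath v w hw
  rw [H.p_eq]
  rcases eq_inS_or_inC v with ⟨v, rfl⟩ | ⟨i, rfl⟩
  · rw [pos_inS]
    rcases IsPath.start_inS hu ha with ⟨c, h, rfl, ha'⟩ | ⟨j, rfl, rfl, rfl⟩ <;>
      rcases IsPath.start_inS hw hb with ⟨c', h', rfl, hb'⟩ | ⟨j', e, rfl, rfl⟩
    · exact E.ext.res.2 v c c' h h' (fun e => hne (e ▸ rfl)) a b ha' hb'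
    · subst e
      rw [angle_comm]
      exact angle_conn_old ha'
    · exact angle_conn_old hb'
    · exact (hne (by rw [E.s_inj e])).elim
  · rw [pos_inC]
    rcases IsPath.start_inC hu ha with ⟨rfl, rfl⟩ | ⟨rfl, rfl⟩ | ⟨j, rfl, rfl, rfl⟩ <;>
      rcases IsPath.start_inC hw hb with ⟨rfl, rfl⟩ | ⟨rfl, rfl⟩ | ⟨j', e, rfl, rfl⟩
    · exact (hne rfl).elim
    · exact E.angle_cycle_cycle i
    · subst e
      rw [angle_comm]
      exact E.angle_conn_cycle j' (Or.inl rfl)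
    · rw [angle_comm]
      exact E.angle_cycle_cycle i
    · exact (hne rfl).elim
    · subst e
      rw [angle_comm]
      exact E.angle_conn_cycle j' (Or.inr rfl)
    · exact E.angle_conn_cycle j (Or.inl rfl)
    · exact E.angle_conn_cycle j (Or.inr rfl)
    · exact (hne (by rw [Subtype.ext e])).elim

/-- The points of the extended drawing. -/
theorem IsExtended.mem_drawingImage (H : E.IsExtended D') {x : Pt} (hx : x ∈ drawingImage D') :
    x ∈ drawingImage D ∨ (∃ j, x ∈ polyImage (E.conn j)) ∨ ∃ i, x ∈ polyImage (E.cyc i) := by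
  rcases hx with ⟨w, rfl⟩ | hx
  · rw [H.p_eq]
    rcases eq_inS_or_inC w with ⟨v, rfl⟩ | ⟨i, rfl⟩
    · rw [pos_inS]
      exact Or.inl (p_mem_drawingImage D v)
    · rw [pos_inC]
      exact Or.inr (Or.inr ⟨i, mem_polyImage_four.2 (Or.inl (left_mem_segment _ _ _))⟩)
  · simp only [Set.mem_iUnion] at hx
    obtain ⟨u, v, h, hx⟩ := hx
    obtain ⟨a, b, l, hl, -, -, e⟩ := H.exists_isPath u v h
    rw [e] at hx
    rcases hl with ⟨a, b, h, rfl, rfl, rfl⟩ | ⟨j, rfl, rfl, rfl⟩ | ⟨i, rfl, rfl, rfl⟩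
    · exact Or.inl (polyImage_seq_subset D h hx)
    · exact Or.inr (Or.inl ⟨j, hx⟩)
    · exact Or.inr (Or.inr ⟨i, hx⟩)

theorem free_of_inS {v : S} (hv : ∃ w, w ∉ S ∪ Set.range f ∧ G.Adj (inS f v : V) w) :
    ∃ w, w ∉ S ∧ G.Adj (v : V) w :=
  hv.imp fun _ h => ⟨fun hS => h.1 (Or.inl hS), h.2⟩

variable (E) in
theorem ne_s_of_free {v : S} (hv : ∃ w, w ∉ S ∪ Set.range f ∧ G.Adj (inS f v : V) w)
    (j : {i // ∃ v : S, G.Adj (f i) v}) : v ≠ E.s j := by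
  rintro rfl
  obtain ⟨w, hw, h⟩ := hv
  exact hw (Or.inr ⟨j.1, (E.s_eq (fun hS => hw (Or.inl hS)) h).symm⟩)

variable (E) in
theorem side_of_free {i : ZMod n} (hv : ∃ w, w ∉ S ∪ Set.range f ∧ G.Adj (inC S f i : V) w) :
    (¬ ∃ v : S, G.Adj (f i) v) ∧ E.side i = 1 := by
  rcases E.side_cases i with ⟨⟨v, h⟩, -⟩ | h
  · obtain ⟨w, hw, h'⟩ := hv
    refine (hw (Or.inl ?_)).elim
    rw [E.third_unique i w v h' h (fun hf => hw (Or.inr hf))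
      fun ⟨k, hk⟩ => E.f_notMem k (hk ▸ v.2)]
    exact v.2
  · exact h

theorem IsExtended.ray_clear (H : E.IsExtended D') (v : (S ∪ Set.range f : Set V))
    (hv : ∃ w, w ∉ S ∪ Set.range f ∧ G.Adj (v : V) w) :
    zRay (D'.p v) ∩ drawingImage D' = ∅ := by
  rw [H.p_eq, Set.eq_empty_iff_forall_notMem]
  rintro x ⟨hr, hx⟩
  have hx := H.mem_drawingImage hx
  rcases eq_inS_or_inC v with ⟨v, rfl⟩ | ⟨i, rfl⟩
  · rw [pos_inS] at hr
    have hp := (mem_zRay_iff.1 hr).1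
    have hv' := free_of_inS hv
    rcases hx with hx | ⟨j, hx⟩ | ⟨i, hx⟩
    · exact (E.ext.ray_clear v hv').le ⟨hr, hx⟩
    · have hne := ne_s_of_free E hv j
      rcases E.conn_cases hx with ⟨a, -⟩ | ⟨a, -⟩ | ⟨a, -⟩
      · exact hne (E.eq_of_shadow_eq hv' (E.s_free j) (hp.symm.trans a))
      · exact E.shadow_notMem hv' j hne (hp ▸ a)
      · exact E.shadow_ne_P (mem_rayShadows D hv') j.1 (hp.symm.trans a)
    · exact E.shadow_cyc hx (hp ▸ mem_rayShadows D hv')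
  · rw [pos_inC] at hr
    have hh := (mem_zRay_iff.1 hr).2
    rw [height_c, (side_of_free E hv).2] at hh
    rcases hx with hx | ⟨j, hx⟩ | ⟨i, hx⟩
    · linarith [E.height_lt_z x hx]
    · linarith [E.conn_height hx]
    · linarith [(E.cyc_height hx).2]

theorem IsExtended.ray_angle (H : E.IsExtended D') (v : (S ∪ Set.range f : Set V))
    (hv : ∃ w, w ∉ S ∪ Set.range f ∧ G.Adj (v : V) w) (u : (S ∪ Set.range f : Set V))
    (h : (G.induce (S ∪ Set.range f)).Adj v u) (a : Pt) (ha : (D'.seq v u h)[1]? = some a) :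
    2 * Real.pi / 3 ≤ angle zDir (a - D'.p v) := by
  have hl := H.seq_isPath v u h
  rw [H.p_eq]
  rcases eq_inS_or_inC v with ⟨v, rfl⟩ | ⟨i, rfl⟩
  · rw [pos_inS]
    rcases IsPath.start_inS hl ha with ⟨b, h', rfl, ha'⟩ | ⟨j, e, -, -⟩
    · exact E.ext.ray_angle v (free_of_inS hv) b h' a ha'
    · exact (ne_s_of_free E hv j e).elim
  · rw [pos_inC]
    obtain ⟨hi, hs⟩ := side_of_free E hv
    rcases IsPath.start_inC hl ha with ⟨-, e⟩ | ⟨-, e⟩ | ⟨j, rfl, -, -⟩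
    · exact E.angle_ray_cycle hs (Or.inl e)
    · exact E.angle_ray_cycle hs (Or.inr e)
    · exact (hi j.2).elim

theorem IsExtended.rays_noncoplanar (H : E.IsExtended D') (v₁ v₂ v₃ : (S ∪ Set.range f : Set V))
    (h₁ : ∃ w, w ∉ S ∪ Set.range f ∧ G.Adj (v₁ : V) w)
    (h₂ : ∃ w, w ∉ S ∪ Set.range f ∧ G.Adj (v₂ : V) w)
    (h₃ : ∃ w, w ∉ S ∪ Set.range f ∧ G.Adj (v₃ : V) w)
    (h₁₂ : v₁ ≠ v₂) (h₁₃ : v₁ ≠ v₃) (h₂₃ : v₂ ≠ v₃) :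
    ¬ Coplanar ℝ (zRay (D'.p v₁) ∪ zRay (D'.p v₂) ∪ zRay (D'.p v₃)) := by
  have hC : ∀ {i j}, inC S f i ≠ inC S f j → i ≠ j := fun h e => h (e ▸ rfl)
  have hS : ∀ {v w : S}, inS f v ≠ inS f w → v ≠ w := fun h e => h (e ▸ rfl)
  have hX : ∀ {v w : S}, (∃ x, x ∉ S ∪ Set.range f ∧ G.Adj (inS f v : V) x) →
      (∃ x, x ∉ S ∪ Set.range f ∧ G.Adj (inS f w : V) x) → inS f v ≠ inS f w →
      ∀ i, crossAt (projPlane (D.p v)) (projPlane (D.p w)) (E.Q.P i) ≠ 0 :=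
    fun hv hw h => E.Q.X_X_P _ (mem_rayShadows D (free_of_inS hv)) _
      (mem_rayShadows D (free_of_inS hw)) fun e =>
        hS h (E.eq_of_shadow_eq (free_of_inS hv) (free_of_inS hw) e)
  have hP : ∀ {v : S}, (∃ x, x ∉ S ∪ Set.range f ∧ G.Adj (inS f v : V) x) → ∀ {i j},
      inC S f i ≠ inC S f j →
      crossAt (projPlane (D.p v)) (E.Q.P i) (E.Q.P j) ≠ 0 := fun hv _ _ h =>
    E.Q.X_P_P _ (mem_rayShadows D (free_of_inS hv)) _ _ (hC h)
  rw [H.p_eq]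
  rcases eq_inS_or_inC v₁ with ⟨a, rfl⟩ | ⟨a, rfl⟩ <;>
    rcases eq_inS_or_inC v₂ with ⟨b, rfl⟩ | ⟨b, rfl⟩ <;>
    rcases eq_inS_or_inC v₃ with ⟨c, rfl⟩ | ⟨c, rfl⟩
  · simp only [pos_inS]
    exact E.ext.rays_noncoplanar a b c (free_of_inS h₁) (free_of_inS h₂) (free_of_inS h₃)
      (hS h₁₂) (hS h₁₃) (hS h₂₃)
  all_goals
    refine not_coplanar_of_crossAt_ne_zero ?_
    simp only [pos_inS, pos_inC, proj_c]
  · exact hX h₁ h₂ h₁₂ c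
  · rw [← crossAt_rotate, ← crossAt_rotate]
    exact hX h₃ h₁ h₁₃.symm b
  · exact hP h₁ h₂₃
  · rw [← crossAt_rotate]
    exact hX h₂ h₃ h₂₃ a
  · rw [← crossAt_rotate]
    exact hP h₂ h₁₃.symm
  · rw [crossAt_rotate]
    exact hP h₃ h₁₂
  · exact E.Q.P_cross a b c (hC h₁₂) (hC h₁₃) (hC h₂₃)

theorem IsExtended.isVertExtensible (H : E.IsExtended D') :
    IsVertExtensible G (S ∪ Set.range f) D' where
  noncross := H.nonCrossing
  bends := H.maxBends
  res := H.angularRes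
  out_unique := by
    intro v w w' hw hw' h h'
    rcases eq_inS_or_inC v with ⟨v, rfl⟩ | ⟨i, rfl⟩
    · exact E.ext.out_unique v w w' (fun hS => hw (Or.inl hS)) (fun hS => hw' (Or.inl hS)) h h'
    · exact E.third_unique i w w' h h' (fun hf => hw (Or.inr hf)) (fun hf => hw' (Or.inr hf))
  ray_clear := H.ray_clear
  ray_angle := H.ray_angle
  rays_noncoplanar := H.rays_noncoplanar

end CycleExtension

/-- If a vertex set `S` of a graph `G` of maximum degree at most three
admits a vertically extensible partial drawing, and `C` is a chordless cycle of length
at least four in the subgraph induced on the complement of `S` (given by an injection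
`f : ZMod n → V`), then `S ∪ C` admits a vertically extensible partial drawing. -/
theorem add_cycle_to_extensible (V : Type) [Fintype V] [DecidableEq V]
    (G : SimpleGraph V) [DecidableRel G.Adj]
    (hdeg : ∀ v, G.degree v ≤ 3) (S : Set V)
    (hS : ∃ D : PolylineDrawing (G.induce S), IsVertExtensible G S D)
    (n : ℕ) (hn : 4 ≤ n) (f : ZMod n → V) (hf : Function.Injective f)
    (hdisj : ∀ i : ZMod n, f i ∉ S)
    (hcyc : ∀ i : ZMod n, G.Adj (f i) (f (i + 1)))
    (hchordless : ∀ i j : ZMod n, G.Adj (f i) (f j) → j = i + 1 ∨ i = j + 1) :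
    ∃ D : PolylineDrawing (G.induce (S ∪ Set.range f)),
      IsVertExtensible G (S ∪ Set.range f) D := by
  obtain ⟨D, hD⟩ := hS
  obtain ⟨E⟩ := exists_cycleExtension G hdeg S D hD n hn f hf hdisj hcyc hchordless
  obtain ⟨D', hD'⟩ := E.exists_isExtended
  exact ⟨D', hD'.isVertExtensible⟩
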